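/- arXiv:2206.07875 — 2 statements merged into one kernel-verified Lean document; each statement's English description precedes it below -/
import Mathlib

section
/- Consider the aggregated iteration with D nonexpansive with respect to ‖·‖_H, α, μ ∈ (0,1), ℓ convex and differentiable with L-Lipschitz gradient and bounded below by M₀, U ⊆ ℝⁿ nonempty convex and compact, s ∈ (0, λ_min(H)/L), and Fix(T) ∩ U nonempty. Let ℓ* := inf{ℓ(u) : u ∈ Fix(T) ∩ U}, D_U := sup{‖u − u'‖_H : u, u' ∈ U}, M := sup{‖∇ℓ(u)‖ : u ∈ U}, C₁ := (3·(D_U² + 2μs(ℓ* − M₀)) + 2μsD_U·M/λ_min(H)) / min{1 − sL/λ_min(H), (1−α)/α, 1}, C₂ := 12·D_U·√C₁, and C₃ := α·(D_U² + 2μs(ℓ* − M₀))/((1−α)(1−μ)). Then for all k ≥ 2: ‖T(u^k) − u^k‖²_H ≤ (2C₂ + C₃)·(1 + ln(1+k))/k^{1/4}. -/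
open scoped RealInnerProductSpace
open Filter Topology

/-- The `H`-inner product `⟨u, v⟩_H = uᵀ H v` on `ℝⁿ`. -/
noncomputable def hIP {n : ℕ} (H : Matrix (Fin n) (Fin n) ℝ)
    (u v : EuclideanSpace ℝ (Fin n)) : ℝ :=
  ⟪u, Matrix.toEuclideanLin H v⟫

/-- The `H`-norm `‖u‖_H = √(uᵀ H u)` on `ℝⁿ`. -/
noncomputable def hNorm {n : ℕ} (H : Matrix (Fin n) (Fin n) ℝ)
    (u : EuclideanSpace ℝ (Fin n)) : ℝ :=
  Real.sqrt (hIP H u u)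

/-- The smallest eigenvalue `λ_min(H)` of a Hermitian matrix `H`. -/
noncomputable def lambdaMin {n : ℕ} (H : Matrix (Fin n) (Fin n) ℝ)
    (hH : H.IsHermitian) : ℝ :=
  ⨅ i, hH.eigenvalues i

set_option maxHeartbeats 1000000 in
theorem aux_scalar (a d r : ℕ → ℝ) (Dm e E m c : ℝ) (hD : 0 ≤ Dm) (he : 0 ≤ e) (hE : 0 ≤ E)
    (hm : 0 < m) (hm1 : m ≤ 1) (hc : 0 < c) (hDE : Dm * E ≤ 2 * (Dm ^ 2 + e))
    (ha : ∀ k, 0 ≤ a k) (haD : ∀ k, a k ≤ Dm ^ 2)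
    (hd : ∀ k, 0 ≤ d k) (hdD : ∀ k, d k ≤ Dm)
    (hdd : ∀ k : ℕ, d (k + 1) ≤ d k + E * (1 / ((k : ℝ) + 1) - 1 / ((k : ℝ) + 2)))
    (h1 : ∀ k : ℕ, m / 2 * d k ^ 2 ≤ a k - a (k + 1) + e * (1 / ((k : ℝ) + 1)))
    (h2 : ∀ k : ℕ, c * r k ^ 2 ≤ a k - a (k + 1) + e * (1 / ((k : ℝ) + 1)))
    (hr : ∀ k, 0 ≤ r k) (hrD : ∀ k, r k ≤ 2 * Dm)
    (hrr : ∀ k, r (k + 1) ≤ r k + 2 * d k) (k : ℕ) (hk : 1 ≤ k) :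
    r k ^ 2 ≤ (24 * Dm * Real.sqrt (3 * (Dm ^ 2 + e) / m) + (Dm ^ 2 + e) / c) *
      (1 + Real.log (1 + (k : ℝ))) / (k : ℝ) ^ ((1 : ℝ) / 4) := by
  set A := Dm ^ 2 + e with hA
  have hA0 : 0 ≤ A := by positivity
  have hharm : ∀ N : ℕ, ∑ j ∈ Finset.range (N + 1), 1 / ((j : ℝ) + 1) ≤ 1 + Real.log (1 + (N : ℝ)) := by
    intro N
    have := harmonic_le_one_add_log (N + 1)
    simp only [harmonic] at this
    push_cast at this
    simpa [add_comm] using this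
  have hL1 : ∀ N : ℕ, 1 ≤ 1 + Real.log (1 + (N : ℝ)) := by
    intro N
    have : 0 ≤ Real.log (1 + (N : ℝ)) := Real.log_nonneg (by linarith [Nat.cast_nonneg (α := ℝ) N])
    linarith
  -- sums
  have hsum : ∀ N : ℕ, ∑ j ∈ Finset.range (N + 1), (a j - a (j + 1) + e * (1 / ((j : ℝ) + 1)))
      ≤ A * (1 + Real.log (1 + (N : ℝ))) := by
    intro N
    rw [Finset.sum_add_distrib, Finset.sum_range_sub', ← Finset.mul_sum]
    have := mul_le_mul_of_nonneg_left (hharm N) he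
    have h0 := haD 0
    have h3 := ha (N + 1)
    nlinarith [hL1 N, sq_nonneg Dm]
  have hdsum : ∀ N : ℕ, m / 2 * ∑ j ∈ Finset.range (N + 1), d j ^ 2
      ≤ A * (1 + Real.log (1 + (N : ℝ))) := by
    intro N
    rw [Finset.mul_sum]
    exact (Finset.sum_le_sum fun j _ => h1 j).trans (hsum N)
  -- quasi-monotonicity
  have hqm : ∀ j i : ℕ, d (j + i) ≤ d j + E * (1 / ((j : ℝ) + 1) - 1 / ((j : ℝ) + i + 1)) := by
    intro j i
    induction i with
    | zero => simp
    | succ i ih =>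
      have := hdd (j + i)
      push_cast at this ⊢
      have e1 : (j : ℝ) + (i + 1) + 1 = j + i + 2 := by ring
      rw [e1]
      rw [← add_assoc] 
      linarith
  have hqm2 : ∀ j N : ℕ, j ≤ N → d N ^ 2 ≤ d j ^ 2 + 4 * A * (1 / ((j : ℝ) + 1)) := by
    intro j N hjN
    obtain ⟨i, rfl⟩ := Nat.exists_eq_add_of_le hjN
    have h := hqm j i
    have hp : 0 ≤ 1 / ((j : ℝ) + i + 1) := by positivity
    have hp2 : 0 ≤ 1 / ((j : ℝ) + 1) := by positivity
    set q := 1 / ((j : ℝ) + 1)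
    have h' : d (j + i) ≤ d j + E * q := by nlinarith
    have hx := hd (j + i)
    have hxD := hdD (j + i)
    have hy := hd j
    have hEq : 0 ≤ E * q := mul_nonneg hE hp2
    have hs1 : d (j + i) ^ 2 ≤ d j ^ 2 + 2 * d (j + i) * (E * q) := by
      by_cases hcs : d (j + i) ≤ E * q
      · nlinarith
      · push Not at hcs
        nlinarith
    have hs2 : d (j + i) * (E * q) ≤ Dm * (E * q) := mul_le_mul_of_nonneg_right hxD hEq
    have hs3 : Dm * E * q ≤ 2 * A * q := mul_le_mul_of_nonneg_right hDE hp2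
    nlinarith
  have hdN : ∀ N : ℕ, ((N : ℝ) + 1) * d N ^ 2 ≤ 6 * (A / m) * (1 + Real.log (1 + (N : ℝ))) := by
    intro N
    have hs : ∑ j ∈ Finset.range (N + 1), d N ^ 2 ≤
        ∑ j ∈ Finset.range (N + 1), (d j ^ 2 + 4 * A * (1 / ((j : ℝ) + 1))) :=
      Finset.sum_le_sum fun j hj => hqm2 j N (by simp at hj; omega)
    rw [Finset.sum_const, Finset.card_range, nsmul_eq_mul, Finset.sum_add_distrib,
      ← Finset.mul_sum] at hs
    push_cast at hs
    have h3 := hdsum N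
    have h4 := mul_le_mul_of_nonneg_left (hharm N) (by positivity : 0 ≤ 4 * A)
    have h5 : ∑ j ∈ Finset.range (N + 1), d j ^ 2 ≤ 2 * (A / m) * (1 + Real.log (1 + (N : ℝ))) := by
      have e2 : 2 * (A / m) * (1 + Real.log (1 + (N : ℝ))) =
        (A * (1 + Real.log (1 + (N : ℝ)))) / (m / 2) := by field_simp
      rw [e2, le_div_iff₀ (by positivity)]
      linarith
    have h6 : A ≤ A / m := by
      rw [le_div_iff₀ hm]; nlinarith
    have h7 := mul_le_mul_of_nonneg_right h6 (by linarith [hL1 N] : 0 ≤ 1 + Real.log (1 + (N : ℝ)))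
    linarith
  -- window
  set Λ := 1 + Real.log (1 + (k : ℝ)) with hΛ
  have hΛ1 : 1 ≤ Λ := hL1 k
  set κ := (k : ℝ) ^ ((1 : ℝ) / 4) with hκ
  have hk0 : (0 : ℝ) < k := by exact_mod_cast hk
  have hk1 : (1 : ℝ) ≤ k := by exact_mod_cast hk
  have hκ0 : 0 < κ := by positivity
  have hκ4 : κ ^ 4 = k := by
    rw [hκ, ← Real.rpow_natCast, ← Real.rpow_mul hk0.le]; norm_num
  have hκ1 : 1 ≤ κ := Real.one_le_rpow hk1 (by norm_num)
  set q := ⌊κ⌋₊ with hq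
  have hq1 : (q : ℝ) ≤ κ := Nat.floor_le hκ0.le
  have hq2 : κ < q + 1 := Nat.lt_floor_add_one κ
  have hκk : κ ≤ ((k : ℝ) + 1) / 2 := by
    nlinarith [sq_nonneg (κ ^ 2 - 1), mul_nonneg (sub_nonneg.2 hκ1) hκ0.le]
  have hqk : q ≤ k := by
    have : (q : ℝ) ≤ k := by linarith
    exact_mod_cast this
  set B := Real.sqrt (3 * A / m) with hB
  have hB0 : 0 ≤ B := Real.sqrt_nonneg _
  have hB2 : B ^ 2 = 3 * (A / m) := by
    rw [hB, Real.sq_sqrt (by positivity)]; ring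
  -- bound of d in window
  have hdw : ∀ i, i ≤ k → k ≤ i + q → d i ≤ 2 * B * Λ / κ ^ 2 := by
    intro i hik hiq
    have h := hdN i
    have hi : (k : ℝ) ≤ i + q := by exact_mod_cast hiq
    have hi2 : κ ^ 4 / 2 ≤ (i : ℝ) + 1 := by rw [hκ4]; linarith
    have hlog : 1 + Real.log (1 + (i : ℝ)) ≤ Λ := by
      have : Real.log (1 + (i : ℝ)) ≤ Real.log (1 + (k : ℝ)) := by
        apply Real.log_le_log (by positivity)
        have : (i : ℝ) ≤ k := by exact_mod_cast hik
        linarith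
      linarith
    have hAm : 0 ≤ A / m := by positivity
    rw [le_div_iff₀ (by positivity)]
    refine (pow_le_pow_iff_left₀ (mul_nonneg (hd i) (by positivity)) (by positivity)
      two_ne_zero).1 ?_
    have g1 : d i ^ 2 * (κ ^ 4 / 2) ≤ d i ^ 2 * ((i : ℝ) + 1) :=
      mul_le_mul_of_nonneg_left hi2 (sq_nonneg _)
    have g2 : 6 * (A / m) * (1 + Real.log (1 + (i : ℝ))) ≤ 6 * (A / m) * Λ :=
      mul_le_mul_of_nonneg_left hlog (by positivity)
    have g3 : (A / m) * Λ ≤ (A / m) * Λ ^ 2 := by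
      apply mul_le_mul_of_nonneg_left _ hAm
      nlinarith
    calc (d i * κ ^ 2) ^ 2 = d i ^ 2 * κ ^ 4 := by ring
      _ ≤ 12 * (A / m * Λ ^ 2) := by linarith
      _ = 4 * B ^ 2 * Λ ^ 2 := by rw [hB2]; ring
      _ = (2 * B * Λ) ^ 2 := by ring
  have hrw : ∀ t, t ≤ q → r k ≤ r (k - t) + 2 * (t * (2 * B * Λ / κ ^ 2)) := by
    intro t
    induction t with
    | zero => simp
    | succ t ih =>
      intro ht
      have h := ih (by omega)
      have h' := hrr (k - (t + 1))
      have e3 : k - (t + 1) + 1 = k - t := by omega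
      rw [e3] at h'
      have h'' := hdw (k - (t + 1)) (by omega) (by omega)
      push_cast
      linarith
  have hrw2 : ∀ t, t ≤ q → r k ^ 2 ≤ r (k - t) ^ 2 + 24 * Dm * B * Λ / κ := by
    intro t ht
    have h := hrw t ht
    have hx := hr k
    have hy := hr (k - t)
    have hxD := hrD k
    have htκ : (t : ℝ) ≤ κ := le_trans (by exact_mod_cast ht) hq1
    have h3 : (t : ℝ) * (2 * B * Λ / κ ^ 2) ≤ 2 * (B * Λ / κ) := by
      have : κ * (2 * B * Λ / κ ^ 2) = 2 * (B * Λ / κ) := by field_simp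
      rw [← this]
      exact mul_le_mul_of_nonneg_right htκ (by positivity)
    set w := B * Λ / κ with hw
    have hw0 : 0 ≤ w := by positivity
    have e4 : 24 * Dm * B * Λ / κ = 24 * Dm * w := by rw [hw]; ring
    rw [e4]
    have h4 : r k ≤ r (k - t) + 4 * w := by linarith
    have hs1 : r k ^ 2 ≤ r (k - t) ^ 2 + 2 * r k * (4 * w) := by
      by_cases hcs : r k ≤ 4 * w
      · nlinarith
      · push Not at hcs
        nlinarith
    nlinarith [mul_nonneg hD hw0]
  have hsumr : c * ∑ j ∈ Finset.range (k + 1), r j ^ 2 ≤ A * Λ := by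
    rw [Finset.mul_sum]
    exact (Finset.sum_le_sum fun j _ => h2 j).trans (hsum k)
  have hsub : ∑ t ∈ Finset.range (q + 1), r (k - t) ^ 2 ≤ ∑ j ∈ Finset.range (k + 1), r j ^ 2 := by
    rw [← Finset.sum_range_reflect (fun j => r j ^ 2) (k + 1)]
    simp only [Nat.add_sub_cancel]
    have hss : Finset.range (q + 1) ⊆ Finset.range (k + 1) :=
      Finset.range_subset_range.2 (Nat.succ_le_succ hqk)
    exact Finset.sum_le_sum_of_subset_of_nonneg hss
      (fun _ _ _ => sq_nonneg _)
  have hfin : ((q : ℝ) + 1) * (r k ^ 2 - 24 * Dm * B * Λ / κ) ≤ A / c * Λ := by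
    have hs : ∑ t ∈ Finset.range (q + 1), (r k ^ 2 - 24 * Dm * B * Λ / κ) ≤
        ∑ t ∈ Finset.range (q + 1), r (k - t) ^ 2 :=
      Finset.sum_le_sum fun t ht => by
        have := hrw2 t (by simp at ht; omega)
        linarith
    rw [Finset.sum_const, Finset.card_range, nsmul_eq_mul] at hs
    push_cast at hs
    refine hs.trans (hsub.trans ?_)
    have e5 : A / c * Λ = A * Λ / c := by ring
    rw [e5, le_div_iff₀ hc]
    linarith
  have e6 : (24 * Dm * B + A / c) * Λ / κ = 24 * Dm * B * Λ / κ + A / c * Λ / κ := by ring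
  rw [e6]
  have : r k ^ 2 - 24 * Dm * B * Λ / κ ≤ A / c * Λ / κ := by
    by_cases hneg : r k ^ 2 - 24 * Dm * B * Λ / κ ≤ 0
    · exact hneg.trans (by positivity)
    · push Not at hneg
      rw [le_div_iff₀ hκ0]
      nlinarith
  linarith

section
variable {X : Type*} [NormedAddCommGroup X] [InnerProductSpace ℝ X]

theorem aux_coco (f : X → ℝ) (g : X → X) (K : ℝ) (hK : 0 < K)
    (hlow : ∀ x y, f x + ⟪g x, y - x⟫ ≤ f y)
    (hup : ∀ x y, f y ≤ f x + ⟪g x, y - x⟫ + K / 2 * ‖y - x‖ ^ 2) (x y : X) :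
    ‖g x - g y‖ ^ 2 ≤ K * ⟪g x - g y, x - y⟫ := by
  have key : ∀ x y, f x + ⟪g x, y - x⟫ + 1 / (2 * K) * ‖g x - g y‖ ^ 2 ≤ f y := by
    intro x y
    have h1 := hlow x (y + (1 / K) • (g x - g y))
    have h2 := hup y (y + (1 / K) • (g x - g y))
    have e1 : y + (1 / K) • (g x - g y) - x = (y - x) + (1 / K) • (g x - g y) := by abel
    have e2 : y + (1 / K) • (g x - g y) - y = (1 / K) • (g x - g y) := by abel
    rw [e1, inner_add_right, inner_smul_right] at h1
    rw [e2, inner_smul_right, norm_smul, mul_pow, Real.norm_eq_abs, sq_abs] at h2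
    have e3 : ⟪g x, g x - g y⟫ - ⟪g y, g x - g y⟫ = ‖g x - g y‖ ^ 2 := by
      rw [← inner_sub_left, real_inner_self_eq_norm_sq]
    have e4 : 1 / K * ⟪g x, g x - g y⟫ - 1 / K * ⟪g y, g x - g y⟫ = 1 / K * ‖g x - g y‖ ^ 2 := by
      rw [← e3]; ring
    have e5 : K / 2 * ((1 / K) ^ 2 * ‖g x - g y‖ ^ 2) = 1 / (2 * K) * ‖g x - g y‖ ^ 2 := by
      field_simp
    have e6 : 1 / K * ‖g x - g y‖ ^ 2 = 2 * (1 / (2 * K) * ‖g x - g y‖ ^ 2) := by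
      field_simp
    linarith
  have h1 := key x y
  have h2 := key y x
  rw [norm_sub_rev (g y)] at h2
  have e1 : ⟪g x, y - x⟫ + ⟪g y, x - y⟫ = - ⟪g x - g y, x - y⟫ := by
    simp only [inner_sub_left, inner_sub_right]; ring
  have e2 : 2 * (1 / (2 * K) * ‖g x - g y‖ ^ 2) = ‖g x - g y‖ ^ 2 / K := by
    field_simp
  have h3 : ‖g x - g y‖ ^ 2 / K ≤ ⟪g x - g y, x - y⟫ := by linarith
  rw [div_le_iff₀ hK] at h3
  linarith

theorem aux_gradstep (f : X → ℝ) (g : X → X) (K : ℝ) (hK : 0 < K)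
    (hlow : ∀ x y, f x + ⟪g x, y - x⟫ ≤ f y)
    (hup : ∀ x y, f y ≤ f x + ⟪g x, y - x⟫ + K / 2 * ‖y - x‖ ^ 2) (x y : X)
    (t : ℝ) (ht : 0 ≤ t) (htK : t * K ≤ 1) :
    ‖(x - t • g x) - (y - t • g y)‖ ≤ ‖x - y‖ := by
  have h := aux_coco f g K hK hlow hup x y
  refine (pow_le_pow_iff_left₀ (norm_nonneg _) (norm_nonneg _) two_ne_zero).1 ?_
  have e : (x - t • g x) - (y - t • g y) = (x - y) - t • (g x - g y) := by
    rw [smul_sub]; abel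
  rw [e, norm_sub_sq_real, inner_smul_right, norm_smul, mul_pow, Real.norm_eq_abs, sq_abs,
    real_inner_comm]
  have h0 : 0 ≤ ⟪g x - g y, x - y⟫ := by
    by_contra hc
    push Not at hc
    nlinarith [sq_nonneg ‖g x - g y‖]
  have h1 : t ^ 2 * ‖g x - g y‖ ^ 2 ≤ t ^ 2 * (K * ⟪g x - g y, x - y⟫) :=
    mul_le_mul_of_nonneg_left h (sq_nonneg _)
  have h2 : t * K * (t * ⟪g x - g y, x - y⟫) ≤ 1 * (t * ⟪g x - g y, x - y⟫) :=
    mul_le_mul_of_nonneg_right htK (mul_nonneg ht h0)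
  nlinarith [mul_nonneg ht h0]

theorem aux_descent (f : X → ℝ) (g : X → X) (K M₀ : ℝ)
    (hlow : ∀ x y, f x + ⟪g x, y - x⟫ ≤ f y)
    (hup : ∀ x y, f y ≤ f x + ⟪g x, y - x⟫ + K / 2 * ‖y - x‖ ^ 2)
    (hM₀ : ∀ x, M₀ ≤ f x) (x p : X) (t : ℝ) (ht : 0 ≤ t) :
    ‖x - t • g x - p‖ ^ 2 ≤ ‖x - p‖ ^ 2 + 2 * t * (f p - M₀) - (1 - t * K) * ‖t • g x‖ ^ 2 := by
  have h1 := hlow x p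
  have h2 := hup x (x - t • g x)
  have h3 := hM₀ (x - t • g x)
  have e1 : x - t • g x - x = - (t • g x) := by abel
  have e2 : x - t • g x - p = (x - p) - t • g x := by abel
  have e3 : ⟪g x, p - x⟫ = - ⟪x - p, g x⟫ := by
    rw [real_inner_comm, ← inner_neg_left, neg_sub]
  rw [e1, inner_neg_right, inner_smul_right, real_inner_self_eq_norm_sq, norm_neg] at h2
  rw [e2, norm_sub_sq_real, inner_smul_right]
  rw [e3] at h1
  have e4 : ‖t • g x‖ ^ 2 = t ^ 2 * ‖g x‖ ^ 2 := by
    rw [norm_smul, mul_pow, Real.norm_eq_abs, sq_abs]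
  rw [e4] at h2 ⊢
  have h4 : M₀ ≤ f p + ⟪x - p, g x⟫ - t * ‖g x‖ ^ 2 + K / 2 * (t ^ 2 * ‖g x‖ ^ 2) := by linarith
  have h5 := mul_le_mul_of_nonneg_left h4 ht
  linarith

theorem aux_gradbound (f : X → ℝ) (g : X → X) (K M₀ s μ Dm : ℝ) (hs : 0 < s) (hsK : s * K ≤ 1)
    (hμ : 0 < μ) (hμ1 : μ ≤ 1) (hD : 0 ≤ Dm)
    (hlow : ∀ x y, f x + ⟪g x, y - x⟫ ≤ f y)
    (hup : ∀ x y, f y ≤ f x + ⟪g x, y - x⟫ + K / 2 * ‖y - x‖ ^ 2)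
    (hM₀ : ∀ x, M₀ ≤ f x) (x p : X) (hxp : ‖x - p‖ ≤ Dm) :
    μ * (s * ‖g x‖) ≤ Dm + Real.sqrt (Dm ^ 2 + 2 * μ * s * (f p - M₀)) := by
  have h1 := hlow x p
  have h2 := hup x (x - s • g x)
  have h3 := hM₀ (x - s • g x)
  have h4 := hM₀ p
  have e1 : x - s • g x - x = - (s • g x) := by abel
  have e3 : ⟪g x, p - x⟫ = - ⟪g x, x - p⟫ := by
    rw [← inner_neg_right, neg_sub]
  rw [e1, inner_neg_right, inner_smul_right, real_inner_self_eq_norm_sq, norm_neg, norm_smul,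
    mul_pow, Real.norm_eq_abs, sq_abs] at h2
  have h5 : ⟪g x, x - p⟫ ≤ ‖g x‖ * Dm :=
    (real_inner_le_norm _ _).trans (mul_le_mul_of_nonneg_left hxp (norm_nonneg _))
  have hG := norm_nonneg (g x)
  set G := ‖g x‖
  have h6 : s * K * (s * G ^ 2) ≤ 1 * (s * G ^ 2) := mul_le_mul_of_nonneg_right hsK (by positivity)
  have h7 : s * G ^ 2 / 2 ≤ f p - M₀ + G * Dm := by linarith
  have h8 : (s * G) ^ 2 ≤ 2 * s * (f p - M₀) + 2 * (s * G) * Dm := by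
    have := mul_le_mul_of_nonneg_left h7 hs.le
    nlinarith
  set y := s * G
  have hy : 0 ≤ y := by positivity
  have h9 : μ ^ 2 * y ^ 2 ≤ μ ^ 2 * (2 * s * (f p - M₀) + 2 * y * Dm) :=
    mul_le_mul_of_nonneg_left h8 (sq_nonneg _)
  have h10 : μ * (μ * (2 * s * (f p - M₀) + 2 * y * Dm)) ≤ 
      1 * (μ * (2 * s * (f p - M₀) + 2 * y * Dm)) := by
    apply mul_le_mul_of_nonneg_right hμ1
    have : 0 ≤ f p - M₀ := by linarith
    positivity
  have h11 : (μ * y - Dm) ^ 2 ≤ Dm ^ 2 + 2 * μ * s * (f p - M₀) := by nlinarith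
  have := Real.le_sqrt_of_sq_le h11
  linarith

theorem aux_comb (P Q : X) (μ : ℝ) : ‖μ • P + (1 - μ) • Q‖ ^ 2 =
    μ * ‖P‖ ^ 2 + (1 - μ) * ‖Q‖ ^ 2 - μ * (1 - μ) * ‖P - Q‖ ^ 2 := by
  rw [norm_add_sq_real, norm_sub_sq_real, inner_smul_left, inner_smul_right,
    norm_smul, norm_smul, mul_pow, mul_pow, Real.norm_eq_abs, Real.norm_eq_abs, sq_abs, sq_abs]
  simp only [conj_trivial]
  ring

theorem aux_main (T : X → X) (f : X → ℝ) (g : X → X) (K M₀ s μ β Dm m : ℝ) (hK : 0 < K)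
    (hs : 0 < s) (hsK : s * K < 1) (hμ : 0 < μ) (hμ1 : μ < 1) (hβ : 0 < β)
    (hmpos : 0 < m) (hm1 : m ≤ 1) (hmβ : m ≤ β) (hmK : m ≤ 1 - s * K)
    (hlow : ∀ x y, f x + ⟪g x, y - x⟫ ≤ f y)
    (hup : ∀ x y, f y ≤ f x + ⟪g x, y - x⟫ + K / 2 * ‖y - x‖ ^ 2)
    (hM₀ : ∀ x, M₀ ≤ f x)
    (hTne : ∀ x y, ‖T x - T y‖ ≤ ‖x - y‖)
    (U : Set X) (p : X) (hpU : p ∈ U) (hTp : T p = p)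
    (hTav : ∀ x, ‖T x - p‖ ^ 2 ≤ ‖x - p‖ ^ 2 - β * ‖T x - x‖ ^ 2)
    (hDm : ∀ x ∈ U, ∀ y ∈ U, ‖x - y‖ ≤ Dm)
    (x z : ℕ → X) (hxU : ∀ k, x k ∈ U)
    (hz : ∀ k : ℕ, z k = μ • (x k - (s / ((k : ℝ) + 1)) • g (x k)) + (1 - μ) • T (x k))
    (hproj : ∀ k, ∀ w ∈ U, ⟪z k - x (k + 1), w - x (k + 1)⟫ ≤ 0) (k : ℕ) (hk : 1 ≤ k) :
    ‖T (x k) - x k‖ ^ 2 ≤ (24 * Dm * Real.sqrt (3 * (Dm ^ 2 + 2 * μ * s * (f p - M₀)) / m) +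
      (Dm ^ 2 + 2 * μ * s * (f p - M₀)) / ((1 - μ) * β)) *
      (1 + Real.log (1 + (k : ℝ))) / (k : ℝ) ^ ((1 : ℝ) / 4) := by
  have hD0 : 0 ≤ Dm := (norm_nonneg _).trans (hDm p hpU p hpU)
  have hδ : 0 ≤ f p - M₀ := by linarith [hM₀ p]
  have hμ' : 0 < 1 - μ := by linarith
  set e := 2 * μ * s * (f p - M₀) with he
  have he0 : 0 ≤ e := by positivity
  have hsq : Dm ≤ Real.sqrt (Dm ^ 2 + e) := Real.le_sqrt_of_sq_le (by linarith)
  -- main recursion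
  have hrec : ∀ k : ℕ, ‖x (k + 1) - p‖ ^ 2 ≤ ‖x k - p‖ ^ 2 + e * (1 / ((k : ℝ) + 1))
      - μ * m * ‖(s / ((k : ℝ) + 1)) • g (x k)‖ ^ 2 - (1 - μ) * β * ‖T (x k) - x k‖ ^ 2
      - ‖x (k + 1) - z k‖ ^ 2
      - μ * (1 - μ) * ‖x k - (s / ((k : ℝ) + 1)) • g (x k) - T (x k)‖ ^ 2 := by
    intro k
    have htpos : 0 ≤ s / ((k : ℝ) + 1) := by positivity
    have hts : s / ((k : ℝ) + 1) ≤ s := div_le_self hs.le (by linarith [Nat.cast_nonneg (α := ℝ) k])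
    set t := s / ((k : ℝ) + 1) with ht
    have hdes := aux_descent f g K M₀ hlow hup hM₀ (x k) p t htpos
    have hav := hTav (x k)
    have hpr := hproj k p hpU
    have e1 : ‖z k - p‖ ^ 2 = ‖x (k + 1) - z k‖ ^ 2 + ‖x (k + 1) - p‖ ^ 2
        - 2 * ⟪z k - x (k + 1), p - x (k + 1)⟫ := by
      have : z k - p = (z k - x (k + 1)) - (p - x (k + 1)) := by abel
      rw [this, norm_sub_sq_real, norm_sub_rev (z k), norm_sub_rev p]; ring
    have e2 : ‖z k - p‖ ^ 2 = μ * ‖x k - t • g (x k) - p‖ ^ 2 + (1 - μ) * ‖T (x k) - p‖ ^ 2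
        - μ * (1 - μ) * ‖x k - t • g (x k) - T (x k)‖ ^ 2 := by
      set P := x k - t • g (x k) - p with hP
      set Q := T (x k) - p with hQ
      have h1 : x k - t • g (x k) - T (x k) = P - Q := by rw [hP, hQ]; abel
      have h2 : z k - p = μ • P + (1 - μ) • Q := by
        rw [hz k, hP, hQ]; module
      rw [h1, h2, aux_comb]
    have hmt : m ≤ 1 - t * K := by nlinarith
    have h3 : m * ‖t • g (x k)‖ ^ 2 ≤ (1 - t * K) * ‖t • g (x k)‖ ^ 2 :=
      mul_le_mul_of_nonneg_right hmt (sq_nonneg _)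
    have h4 : ‖x k - t • g (x k) - p‖ ^ 2 ≤ ‖x k - p‖ ^ 2 + 2 * t * (f p - M₀)
       - m * ‖t • g (x k)‖ ^ 2 := by linarith
    have h5 := mul_le_mul_of_nonneg_left h4 hμ.le
    have h6 := mul_le_mul_of_nonneg_left hav hμ'.le
    have e3 : e * (1 / ((k : ℝ) + 1)) = μ * (2 * t * (f p - M₀)) := by
      rw [he, ht]; ring
    rw [e3]
    nlinarith
  have hgs : ∀ k, μ * (s * ‖g (x k)‖) ≤ 2 * Real.sqrt (Dm ^ 2 + e) := by
    intro k
    have := aux_gradbound f g K M₀ s μ Dm hs hsK.le hμ hμ1.le hD0 hlow hup hM₀ (x k) p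
      (hDm _ (hxU k) _ hpU)
    linarith
  refine aux_scalar (fun k => ‖x k - p‖ ^ 2) (fun k => ‖x (k + 1) - x k‖)
    (fun k => ‖T (x k) - x k‖) Dm e (2 * Real.sqrt (Dm ^ 2 + e)) m ((1 - μ) * β) hD0 he0
    (by positivity) hmpos hm1 (by positivity) ?_ (fun _ => sq_nonneg _) ?_ (fun _ => norm_nonneg _)
    ?_ ?_ ?_ ?_ (fun _ => norm_nonneg _) ?_ ?_ k hk
  · nlinarith [Real.sq_sqrt (by positivity : 0 ≤ Dm ^ 2 + e), Real.sqrt_nonneg (Dm ^ 2 + e)]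
  · intro k
    exact pow_le_pow_left₀ (norm_nonneg _) (hDm _ (hxU k) _ hpU) 2
  · intro k
    exact hDm _ (hxU _) _ (hxU _)
  · intro k
    show ‖x (k + 1 + 1) - x (k + 1)‖ ≤ ‖x (k + 1) - x k‖ + _
    have hne : ‖x (k + 1 + 1) - x (k + 1)‖ ≤ ‖z (k + 1) - z k‖ := by
      have h1 := hproj k _ (hxU (k + 1 + 1))
      have h2 := hproj (k + 1) _ (hxU (k + 1))
      have h3 : ‖x (k + 1 + 1) - x (k + 1)‖ ^ 2 ≤ ⟪z (k + 1) - z k, x (k + 1 + 1) - x (k + 1)⟫ := by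
        rw [← real_inner_self_eq_norm_sq]
        simp only [inner_sub_left, inner_sub_right] at *
        linarith
      have h4 := h3.trans (real_inner_le_norm _ _)
      rcases (norm_nonneg (x (k + 1 + 1) - x (k + 1))).eq_or_lt with h0 | h0
      · rw [← h0]; exact norm_nonneg _
      · nlinarith
    refine hne.trans ?_
    have htpos : 0 ≤ s / ((k : ℝ) + 1) := by positivity
    have hts : s / ((k : ℝ) + 1) ≤ s := div_le_self hs.le (by linarith [Nat.cast_nonneg (α := ℝ) k])
    have hdif : 0 ≤ 1 / ((k : ℝ) + 1) - 1 / ((k : ℝ) + 2) := by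
      rw [sub_nonneg]
      exact one_div_le_one_div_of_le (by positivity) (by linarith)
    have hg1 := aux_gradstep f g K hK hlow hup (x (k + 1)) (x k) _ htpos (by nlinarith)
    have hT1 := hTne (x (k + 1)) (x k)
    have e1 : z (k + 1) - z k = μ • ((x (k + 1) - (s / ((k : ℝ) + 1)) • g (x (k + 1)))
        - (x k - (s / ((k : ℝ) + 1)) • g (x k))) + (1 - μ) • (T (x (k + 1)) - T (x k))
        + (μ * (s * (1 / ((k : ℝ) + 1) - 1 / ((k : ℝ) + 2)))) • g (x (k + 1)) := by
      have e2 : ((k + 1 : ℕ) : ℝ) + 1 = (k : ℝ) + 2 := by push_cast; ring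
      rw [hz, hz, e2]
      rw [div_eq_mul_one_div s ((k : ℝ) + 2), div_eq_mul_one_div s ((k : ℝ) + 1)]
      generalize 1 / ((k : ℝ) + 2) = q2
      generalize 1 / ((k : ℝ) + 1) = q1
      module
    rw [e1]
    refine (norm_add₃_le).trans ?_
    rw [norm_smul, norm_smul, norm_smul, Real.norm_of_nonneg hμ.le, Real.norm_of_nonneg hμ'.le,
      Real.norm_of_nonneg (by positivity)]
    have h1 := mul_le_mul_of_nonneg_left hg1 hμ.le
    have h2 := mul_le_mul_of_nonneg_left hT1 hμ'.le
    have h3 := mul_le_mul_of_nonneg_right (hgs (k + 1)) hdif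
    linarith
  · intro k
    show m / 2 * ‖x (k + 1) - x k‖ ^ 2 ≤ ‖x k - p‖ ^ 2 - ‖x (k + 1) - p‖ ^ 2 + _
    have h := hrec k
    set t := s / ((k : ℝ) + 1) with ht
    set P := - (t • g (x k)) with hP
    set Q := T (x k) - x k with hQ
    have h1 : x k - t • g (x k) - T (x k) = P - Q := by rw [hP, hQ]; abel
    have h2 : z k - x k = μ • P + (1 - μ) • Q := by
      rw [hz k, hP, hQ]; module
    have e2 : ‖z k - x k‖ ^ 2 = μ * ‖P‖ ^ 2 + (1 - μ) * ‖Q‖ ^ 2 - μ * (1 - μ) * ‖P - Q‖ ^ 2 := by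
      rw [h2, aux_comb]
    have e3 : ‖t • g (x k)‖ = ‖P‖ := by rw [hP, norm_neg]
    rw [h1, e3] at h
    have h4 : ‖x (k + 1) - x k‖ ^ 2 ≤ 2 * ‖x (k + 1) - z k‖ ^ 2 + 2 * ‖z k - x k‖ ^ 2 := by
      have e5 : ‖x (k + 1) - x k‖ ≤ ‖x (k + 1) - z k‖ + ‖z k - x k‖ := norm_sub_le_norm_sub_add_norm_sub _ _ _
      have := pow_le_pow_left₀ (norm_nonneg _) e5 2
      nlinarith [sq_nonneg (‖x (k + 1) - z k‖ - ‖z k - x k‖)]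
    have h5 := mul_le_mul_of_nonneg_left h4 (by positivity : 0 ≤ m / 2)
    have h6 : m * ‖x (k + 1) - z k‖ ^ 2 ≤ 1 * ‖x (k + 1) - z k‖ ^ 2 :=
      mul_le_mul_of_nonneg_right hm1 (sq_nonneg _)
    have h7 : (1 - μ) * ‖Q‖ ^ 2 * m ≤ (1 - μ) * ‖Q‖ ^ 2 * β :=
      mul_le_mul_of_nonneg_left hmβ (by positivity)
    have h8 : 0 ≤ m * (μ * (1 - μ) * ‖P - Q‖ ^ 2) := by positivity
    have h9 : 0 ≤ (μ * (1 - μ) * ‖P - Q‖ ^ 2) := by positivity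
    rw [e2] at h5
    linarith
  · intro k
    show _ ≤ ‖x k - p‖ ^ 2 - ‖x (k + 1) - p‖ ^ 2 + _
    have h := hrec k
    have h1 : 0 ≤ μ * m * ‖(s / ((k : ℝ) + 1)) • g (x k)‖ ^ 2 := by positivity
    have h2 : 0 ≤ μ * (1 - μ) * ‖x k - (s / ((k : ℝ) + 1)) • g (x k) - T (x k)‖ ^ 2 := by positivity
    have h3 := sq_nonneg ‖x (k + 1) - z k‖
    show (1 - μ) * β * ‖T (x k) - x k‖ ^ 2 ≤ _
    linarith
  · intro k
    have h1 := hTne (x k) p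
    rw [hTp] at h1
    have h2 := hDm _ (hxU k) _ hpU
    have h3 : ‖T (x k) - x k‖ ≤ ‖T (x k) - p‖ + ‖p - x k‖ := norm_sub_le_norm_sub_add_norm_sub _ _ _
    rw [norm_sub_rev p] at h3
    show ‖T (x k) - x k‖ ≤ _
    linarith
  · intro k
    show ‖T (x (k + 1)) - x (k + 1)‖ ≤ ‖T (x k) - x k‖ + 2 * ‖x (k + 1) - x k‖
    have e1 : T (x (k + 1)) - x (k + 1) = (T (x (k + 1)) - T (x k)) + (T (x k) - x k)
      + (x k - x (k + 1)) := by abel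
    have h1 := hTne (x (k + 1)) (x k)
    rw [e1]
    refine norm_add₃_le.trans ?_
    rw [norm_sub_rev (x k)]
    linarith
end

theorem aux_low {X : Type*} [NormedAddCommGroup X] [InnerProductSpace ℝ X] [CompleteSpace X]
    (f : X → ℝ) (hconv : ConvexOn ℝ Set.univ f) (hdiff : Differentiable ℝ f) (x y : X) :
    f x + ⟪gradient f x, y - x⟫ ≤ f y := by
  have hline : ∀ t : ℝ, HasDerivAt (fun t : ℝ => f (x + t • (y - x)))
      ⟪gradient f (x + t • (y - x)), y - x⟫ t := by
    intro t
    have h1 := (hdiff (x + t • (y - x))).hasGradientAt.hasFDerivAt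
    have h2 : HasDerivAt (fun t : ℝ => x + t • (y - x)) (y - x) t := by
      simpa using ((hasDerivAt_id t).smul_const (y - x)).const_add x
    exact h1.comp_hasDerivAt t h2
  have hc : ConvexOn ℝ Set.univ (fun t : ℝ => f (x + t • (y - x))) := by
    refine ⟨convex_univ, fun a _ b _ p q hp hq hpq => ?_⟩
    have := hconv.2 (Set.mem_univ (x + a • (y - x))) (Set.mem_univ (x + b • (y - x))) hp hq hpq
    refine le_trans (le_of_eq ?_) this
    show f _ = f _
    congr 1
    have : x = (p + q) • x := by rw [hpq, one_smul]
    nth_rewrite 1 [this]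
    simp only [smul_eq_mul]
    module
  have h := hc.le_slope_of_hasDerivAt (Set.mem_univ (0 : ℝ)) (Set.mem_univ 1) one_pos (hline 0)
  simp only [slope, zero_smul, one_smul, add_zero, sub_zero, inv_one, add_sub_cancel,
    vsub_eq_sub] at h
  linarith

theorem aux_up {X : Type*} [NormedAddCommGroup X] [InnerProductSpace ℝ X] [CompleteSpace X]
    (f : X → ℝ) (hdiff : Differentiable ℝ f) (L : ℝ)
    (hLip : ∀ u v, ‖gradient f u - gradient f v‖ ≤ L * ‖u - v‖) (x y : X) :
    f y ≤ f x + ⟪gradient f x, y - x⟫ + L / 2 * ‖y - x‖ ^ 2 := by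
  have hline : ∀ t : ℝ, HasDerivAt (fun t : ℝ => f (x + t • (y - x)))
      ⟪gradient f (x + t • (y - x)), y - x⟫ t := by
    intro t
    have h1 := (hdiff (x + t • (y - x))).hasGradientAt.hasFDerivAt
    have h2 : HasDerivAt (fun t : ℝ => x + t • (y - x)) (y - x) t := by
      simpa using ((hasDerivAt_id t).smul_const (y - x)).const_add x
    exact h1.comp_hasDerivAt t h2
  have hB : ∀ t : ℝ, HasDerivAt (fun t : ℝ => f x + t * ⟪gradient f x, y - x⟫ +
      L / 2 * ‖y - x‖ ^ 2 * t ^ 2) (⟪gradient f x, y - x⟫ + L * ‖y - x‖ ^ 2 * t) t := by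
    intro t
    have h1 := ((hasDerivAt_id t).mul_const ⟪gradient f x, y - x⟫).const_add (f x)
    have h2 := ((hasDerivAt_id t).pow 2).const_mul (L / 2 * ‖y - x‖ ^ 2)
    refine (h1.add h2).congr_deriv ?_
    simp
    ring
  have := image_le_of_deriv_right_le_deriv_boundary (a := (0 : ℝ)) (b := 1)
    (fun t _ => (hline t).continuousAt.continuousWithinAt)
    (fun t _ => (hline t).hasDerivWithinAt) (by simp)
    (fun t _ => (hB t).continuousAt.continuousWithinAt)
    (fun t _ => (hB t).hasDerivWithinAt) (fun t ht => ?_) (Set.right_mem_Icc.2 zero_le_one)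
  · simpa using this
  · have h1 := hLip (x + t • (y - x)) x
    have e : x + t • (y - x) - x = t • (y - x) := by abel
    rw [e, norm_smul, Real.norm_of_nonneg ht.1] at h1
    have h2 := real_inner_le_norm (gradient f (x + t • (y - x)) - gradient f x) (y - x)
    rw [inner_sub_left] at h2
    have h3 := mul_le_mul_of_nonneg_right h1 (norm_nonneg (y - x))
    nlinarith

theorem aux_lam {n : ℕ} (H : Matrix (Fin n) (Fin n) ℝ) (hH : H.IsHermitian)
    (v : EuclideanSpace ℝ (Fin n)) :
    (⨅ i, hH.eigenvalues i) * ‖v‖ ^ 2 ≤ ⟪v, Matrix.toEuclideanLin H v⟫ := by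
  have hsym := Matrix.isSymmetric_toEuclideanLin_iff.2 hH
  have he : ∀ i, Matrix.toEuclideanLin H (hH.eigenvectorBasis i) =
      hH.eigenvalues i • hH.eigenvectorBasis i := by
    intro i
    have := hH.mulVec_eigenvectorBasis i
    rw [Matrix.toLpLin_apply, this]
    rfl
  rw [← real_inner_self_eq_norm_sq, ← hH.eigenvectorBasis.sum_inner_mul_inner v v,
    ← hH.eigenvectorBasis.sum_inner_mul_inner v (Matrix.toEuclideanLin H v), Finset.mul_sum]
  refine Finset.sum_le_sum fun i _ => ?_
  rw [← hsym, he, inner_smul_left, real_inner_comm v]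
  simp only [conj_trivial]
  have h1 : (⨅ i, hH.eigenvalues i) ≤ hH.eigenvalues i := ciInf_le (Set.finite_range _).bddBelow i
  nlinarith [mul_self_nonneg ⟪hH.eigenvectorBasis i, v⟫]

theorem aux_S {n : ℕ} (H : Matrix (Fin n) (Fin n) ℝ) (hH : H.PosDef) :
    ∃ S : EuclideanSpace ℝ (Fin n) ≃ₗ[ℝ] EuclideanSpace ℝ (Fin n),
      ∀ u v, ⟪S u, S v⟫ = ⟪u, Matrix.toEuclideanLin H v⟫ := by
  obtain ⟨B, hB⟩ : ∃ B : Matrix (Fin n) (Fin n) ℝ, H = B.conjTranspose * B := by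
    open scoped MatrixOrder in
    have := hH.posSemidef
    have h0 : 0 ≤ H := Matrix.nonneg_iff_posSemidef.2 this
    exact CStarAlgebra.nonneg_iff_eq_star_mul_self.1 h0
  have hin : ∀ u v, ⟪Matrix.toEuclideanLin B u, Matrix.toEuclideanLin B v⟫ = 
      ⟪u, Matrix.toEuclideanLin H v⟫ := by
    intro u v
    rw [hB, Matrix.toLpLin_mul_same, LinearMap.comp_apply, 
      Matrix.toEuclideanLin_conjTranspose_eq_adjoint, LinearMap.adjoint_inner_right]
  have hinj : Function.Injective (Matrix.toEuclideanLin B) := by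
    rw [← LinearMap.ker_eq_bot, LinearMap.ker_eq_bot']
    intro v hv
    by_contra hne
    have h := hin v v
    rw [hv, inner_zero_left] at h
    have := hH.dotProduct_mulVec_pos (x := v.ofLp) (by simpa using hne)
    simp [EuclideanSpace.inner_eq_star_dotProduct, Matrix.toLpLin_apply, dotProduct_comm] at h this
    linarith
  exact ⟨LinearEquiv.ofInjectiveEndo _ hinj, hin⟩

/-- fixed-point residual rate for the aggregated iteration
(Proposition A.5 of the paper): for `k ≥ 2`,
`‖T(u^k) − u^k‖²_H ≤ (2C₂ + C₃)(1 + ln(1+k))/k^{1/4}`. -/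
theorem stmt_10 {n : ℕ} (H : Matrix (Fin n) (Fin n) ℝ) (hH : H.PosDef)
    (D : EuclideanSpace ℝ (Fin n) → EuclideanSpace ℝ (Fin n))
    (hD : ∀ u₁ u₂, hNorm H (D u₁ - D u₂) ≤ hNorm H (u₁ - u₂))
    (ℓ : EuclideanSpace ℝ (Fin n) → ℝ)
    (hconv : ConvexOn ℝ Set.univ ℓ) (hdiff : Differentiable ℝ ℓ)
    (L : ℝ) (hL : 0 < L)
    (hLip : ∀ u v, ‖gradient ℓ u - gradient ℓ v‖ ≤ L * ‖u - v‖)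
    (M₀ : ℝ) (hM₀ : ∀ x, M₀ ≤ ℓ x)
    (α μ : ℝ) (hα : α ∈ Set.Ioo (0 : ℝ) 1) (hμ : μ ∈ Set.Ioo (0 : ℝ) 1)
    (s : ℝ) (hs : s ∈ Set.Ioo 0 (lambdaMin H hH.1 / L))
    (U : Set (EuclideanSpace ℝ (Fin n)))
    (hUne : U.Nonempty) (hUcp : IsCompact U) (hUco : Convex ℝ U)
    (T : EuclideanSpace ℝ (Fin n) → EuclideanSpace ℝ (Fin n))
    (hT : ∀ u, T u = (1 - α) • u + α • D u)
    (hFix : ({y | T y = y} ∩ U).Nonempty)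
    (lstar : ℝ) (hlstar : lstar = sInf (ℓ '' ({y | T y = y} ∩ U)))
    (DU M : ℝ)
    (hDU : DU = sSup ((fun p : EuclideanSpace ℝ (Fin n) × EuclideanSpace ℝ (Fin n) =>
      hNorm H (p.1 - p.2)) '' (U ×ˢ U)))
    (hM : M = sSup ((fun x => ‖gradient ℓ x‖) '' U))
    (C₁ C₂ C₃ : ℝ)
    (hC₁ : C₁ = (3 * (DU ^ 2 + 2 * μ * s * (lstar - M₀))
        + 2 * μ * s * DU * M / lambdaMin H hH.1) /
      min (1 - s * L / lambdaMin H hH.1) (min ((1 - α) / α) 1))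
    (hC₂ : C₂ = 12 * DU * Real.sqrt C₁)
    (hC₃ : C₃ = α * (DU ^ 2 + 2 * μ * s * (lstar - M₀)) / ((1 - α) * (1 - μ)))
    (u vl vu : ℕ → EuclideanSpace ℝ (Fin n))
    (hu0 : u 0 ∈ U)
    (hvl : ∀ k, vl (k + 1) = T (u k))
    (hvu : ∀ k, vu (k + 1) =
      u k - (s / ((k : ℝ) + 1)) • Matrix.toEuclideanLin H⁻¹ (gradient ℓ (u k)))
    (hproj : ∀ k, u (k + 1) ∈ U ∧ ∀ w ∈ U,
      hNorm H (u (k + 1) - (μ • vu (k + 1) + (1 - μ) • vl (k + 1))) ≤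
        hNorm H (w - (μ • vu (k + 1) + (1 - μ) • vl (k + 1)))) :
    ∀ k : ℕ, 2 ≤ k →
      hNorm H (T (u k) - u k) ^ 2 ≤
        (2 * C₂ + C₃) * (1 + Real.log (1 + (k : ℝ))) / (k : ℝ) ^ ((1 : ℝ) / 4) := by
  obtain ⟨S, hS⟩ := aux_S H hH
  have hN : ∀ v, hNorm H v = ‖S v‖ := by
    intro v
    rw [hNorm, hIP, ← hS, real_inner_self_eq_norm_sq, Real.sqrt_sq (norm_nonneg _)]
  simp only [hN] at hD hDU hproj ⊢
  have hlamB : ∀ v, lambdaMin H hH.1 * ‖v‖ ^ 2 ≤ ‖S v‖ ^ 2 := by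
    intro v
    rw [← real_inner_self_eq_norm_sq (S v), hS]
    exact aux_lam H hH.1 v
  generalize lambdaMin H hH.1 = lam at *
  obtain ⟨hα0, hα1⟩ := hα
  obtain ⟨hμ0, hμ1⟩ := hμ
  obtain ⟨hs0, hs1⟩ := hs
  have hlam : 0 < lam := by
    by_contra hc
    push Not at hc
    have : lam / L ≤ 0 := div_nonpos_of_nonpos_of_nonneg hc hL.le
    linarith
  have hsL : s * L / lam < 1 := by
    rw [div_lt_one hlam]
    rwa [lt_div_iff₀ hL] at hs1
  have hScont : Continuous S := S.toLinearMap.continuous_of_finiteDimensional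
  have hSscont : Continuous S.symm := S.symm.toLinearMap.continuous_of_finiteDimensional
  -- inner product with the preconditioned gradient
  have hinner : ∀ a b, ⟪S (Matrix.toEuclideanLin H⁻¹ a), S b⟫ = ⟪a, b⟫ := by
    intro a b
    have hsym := Matrix.isSymmetric_toEuclideanLin_iff.2 hH.1
    have hu : IsUnit H.det := hH.det_pos.ne'.isUnit
    rw [hS, ← hsym, ← LinearMap.comp_apply, ← Matrix.toLpLin_mul_same,
      Matrix.mul_nonsing_inv H hu, Matrix.toLpLin_one, LinearMap.id_apply]
  have hTα : ∀ x y, S (T x) - S (T y) = α • (S (D x - D y)) + (1 - α) • (S (x - y)) := by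
    intro x y
    rw [hT, hT, ← map_sub, ← map_smul, ← map_smul, ← map_add]
    congr 1
    module
  have hTne : ∀ x y, ‖S (T x) - S (T y)‖ ≤ ‖S x - S y‖ := by
    intro x y
    rw [hTα]
    refine (norm_add_le _ _).trans ?_
    rw [norm_smul, norm_smul, Real.norm_of_nonneg hα0.le, Real.norm_of_nonneg (by linarith),
      ← map_sub]
    nlinarith [hD x y]
  have hTcont : Continuous T := by
    have h1 : LipschitzWith 1 (fun x => S (T (S.symm x))) := by
      refine LipschitzWith.of_dist_le_mul fun x y => ?_
      rw [dist_eq_norm, dist_eq_norm]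
      simpa using hTne (S.symm x) (S.symm y)
    have h2 := hSscont.comp (h1.continuous.comp hScont)
    have h3 : S.symm ∘ (fun x => S (T (S.symm x))) ∘ S = T := by
      funext x; simp
    rwa [h3] at h2
  -- minimizer on the fixed point set
  have hcp : IsCompact ({y | T y = y} ∩ U) :=
    hUcp.inter_left (isClosed_eq hTcont continuous_id)
  obtain ⟨p, ⟨hpT, hpU⟩, hpmin⟩ := hcp.exists_isMinOn hFix hdiff.continuous.continuousOn
  have hpT : T p = p := hpT
  have hlp : lstar = ℓ p := by
    rw [hlstar]
    apply le_antisymm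
    · exact csInf_le ⟨M₀, by rintro _ ⟨y, _, rfl⟩; exact hM₀ y⟩ ⟨p, ⟨hpT, hpU⟩, rfl⟩
    · refine le_csInf (hFix.image _) ?_
      rintro _ ⟨y, hy, rfl⟩
      exact hpmin hy
  have hDp : D p = p := by
    have h := hT p
    rw [hpT] at h
    have h2 : α • (D p - p) = 0 := by
      have : α • (D p - p) = ((1 - α) • p + α • D p) - p := by module
      rw [this, ← h, sub_self]
    have h3 := (smul_eq_zero.1 h2).resolve_left hα0.ne'
    exact sub_eq_zero.1 h3
  have hDUb : ∀ x ∈ U, ∀ y ∈ U, ‖S x - S y‖ ≤ DU := by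
    intro x hx y hy
    rw [hDU, ← map_sub]
    refine le_csSup ?_ ⟨(x, y), ⟨hx, hy⟩, rfl⟩
    have hc : Continuous (fun q : EuclideanSpace ℝ (Fin n) × EuclideanSpace ℝ (Fin n) =>
        ‖S (q.1 - q.2)‖) := (hScont.comp (continuous_fst.sub continuous_snd)).norm
    exact ((hUcp.prod hUcp).image hc).bddAbove
  have hM0 : 0 ≤ M := by
    rw [hM]
    apply Real.sSup_nonneg
    rintro _ ⟨y, _, rfl⟩
    exact norm_nonneg _
  have hDU0 : 0 ≤ DU := (norm_nonneg _).trans (hDUb p hpU p hpU)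
  have huU : ∀ k, u k ∈ U := by
    intro k
    cases k with
    | zero => exact hu0
    | succ k => exact (hproj k).1
  set m := min (1 - s * L / lam) (min ((1 - α) / α) 1) with hm
  have hβ : 0 < (1 - α) / α := div_pos (by linarith) hα0
  have hm0 : 0 < m := lt_min (by linarith) (lt_min hβ one_pos)
  have hm1 : m ≤ 1 := (min_le_right _ _).trans (min_le_right _ _)
  have hm2 : m ≤ (1 - α) / α := (min_le_right _ _).trans (min_le_left _ _)
  have hm3 : m ≤ 1 - s * (L / lam) := by
    rw [← mul_div_assoc]; exact min_le_left _ _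
  intro k hk
  have hmain := aux_main (fun x => S (T (S.symm x))) (fun x => ℓ (S.symm x))
    (fun x => S (Matrix.toEuclideanLin H⁻¹ (gradient ℓ (S.symm x)))) (L / lam) M₀ s μ
    ((1 - α) / α) DU m (by positivity) hs0 (by rw [← mul_div_assoc]; exact hsL) hμ0 hμ1 hβ hm0 hm1
    hm2 hm3 ?_ ?_ (fun x => hM₀ _) ?_ (S '' U) (S p) ⟨p, hpU, rfl⟩ ?_ ?_ ?_ (fun k => S (u k))
    (fun k => S (μ • vu (k + 1) + (1 - μ) • vl (k + 1))) (fun k => ⟨u k, huU k, rfl⟩) ?_ ?_ k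
    (by omega)
  · simp only [LinearEquiv.symm_apply_apply, ← hlp] at hmain
    rw [map_sub]
    refine hmain.trans ?_
    have hA0 : 0 ≤ DU ^ 2 + 2 * μ * s * (lstar - M₀) := by
      have : 0 ≤ lstar - M₀ := by rw [hlp]; linarith [hM₀ p]
      positivity
    have hlog : 0 ≤ Real.log (1 + (k : ℝ)) :=
      Real.log_nonneg (by linarith [Nat.cast_nonneg (α := ℝ) k])
    have hC1le : 3 * (DU ^ 2 + 2 * μ * s * (lstar - M₀)) / m ≤ C₁ := by
      rw [hC₁]
      apply div_le_div_of_nonneg_right _ hm0.le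
      have : 0 ≤ 2 * μ * s * DU * M / lam := by positivity
      linarith
    have hC3e : (DU ^ 2 + 2 * μ * s * (lstar - M₀)) / ((1 - μ) * ((1 - α) / α)) = C₃ := by
      rw [hC₃]
      have h1 : (1 - μ) ≠ 0 := by linarith
      have h2 : (1 - α) ≠ 0 := by linarith
      field_simp
    rw [hC3e]
    apply div_le_div_of_nonneg_right _ (by positivity)
    apply mul_le_mul_of_nonneg_right _ (by linarith)
    have h4 := mul_le_mul_of_nonneg_left (Real.sqrt_le_sqrt hC1le)
      (by positivity : 0 ≤ 24 * DU)
    rw [hC₂]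
    linarith
  · intro x y
    have h := aux_low ℓ hconv hdiff (S.symm x) (S.symm y)
    have h2 := hinner (gradient ℓ (S.symm x)) (S.symm y - S.symm x)
    rw [map_sub, LinearEquiv.apply_symm_apply, LinearEquiv.apply_symm_apply] at h2
    rw [h2]
    exact h
  · intro x y
    have h := aux_up ℓ hdiff L hLip (S.symm x) (S.symm y)
    have h2 := hinner (gradient ℓ (S.symm x)) (S.symm y - S.symm x)
    have h3 := hlamB (S.symm y - S.symm x)
    rw [map_sub, LinearEquiv.apply_symm_apply, LinearEquiv.apply_symm_apply] at h2 h3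
    rw [h2]
    refine h.trans ?_
    have h4 : ‖S.symm y - S.symm x‖ ^ 2 ≤ ‖y - x‖ ^ 2 / lam := by
      rw [le_div_iff₀ hlam]; linarith
    have h5 := mul_le_mul_of_nonneg_left h4 (by positivity : 0 ≤ L / 2)
    have e1 : L / 2 * (‖y - x‖ ^ 2 / lam) = L / lam / 2 * ‖y - x‖ ^ 2 := by ring
    linarith
  · intro x y
    simpa using hTne (S.symm x) (S.symm y)
  · simp [hpT]
  · intro x
    have e1 := hTα (S.symm x) p
    rw [hpT, hDp] at e1
    have e2 : S (T (S.symm x)) - x = α • (S (D (S.symm x) - p) - S (S.symm x - p)) := by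
      have : S (T (S.symm x)) - x = (S (T (S.symm x)) - S p) - S (S.symm x - p) := by
        rw [map_sub, LinearEquiv.apply_symm_apply]; abel
      rw [this, e1]; module
    have h1 := hD (S.symm x) p
    rw [hDp] at h1
    have h2 := pow_le_pow_left₀ (norm_nonneg _) h1 2
    show ‖S (T (S.symm x)) - S p‖ ^ 2 ≤ ‖x - S p‖ ^ 2 - (1 - α) / α * ‖S (T (S.symm x)) - x‖ ^ 2
    rw [e1, e2, aux_comb, norm_smul, mul_pow, Real.norm_eq_abs, sq_abs]
    have e3 : x - S p = S (S.symm x - p) := by rw [map_sub, LinearEquiv.apply_symm_apply]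
    rw [e3]
    have e4 : ∀ c : ℝ, (1 - α) / α * (α ^ 2 * c) = α * (1 - α) * c := by
      intro c; field_simp
    rw [e4]
    nlinarith
  · rintro _ ⟨x, hx, rfl⟩ _ ⟨y, hy, rfl⟩
    exact hDUb x hx y hy
  · intro k
    simp only [LinearEquiv.symm_apply_apply]
    rw [hvu, hvl, map_add, map_smul, map_smul, map_sub, map_smul]
  · intro k
    have hconvS : Convex ℝ (S '' U) := hUco.linear_image S.toLinearMap
    refine (norm_eq_iInf_iff_real_inner_le_zero hconvS ⟨u (k + 1), huU _, rfl⟩).1 ?_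
    have hmemU : S (u (k + 1)) ∈ S '' U := ⟨u (k + 1), huU _, rfl⟩
    haveI : Nonempty (S '' U) := ⟨⟨_, hmemU⟩⟩
    apply le_antisymm
    · refine le_ciInf ?_
      rintro ⟨_, w, hw, rfl⟩
      have := (hproj k).2 w hw
      rw [map_sub, map_sub] at this
      rw [norm_sub_rev, norm_sub_rev _ (S w)]
      exact this
    · exact ciInf_le ⟨0, by rintro _ ⟨w, rfl⟩; exact norm_nonneg _⟩
        (⟨_, hmemU⟩ : (S '' U : Set (EuclideanSpace ℝ (Fin n))))
end

section
/- Consider the parameterized aggregated iteration with Ω ⊆ ℝ^m compact, U ⊆ ℝⁿ nonempty convex and compact, ℓ : ℝⁿ × Ω → ℝ continuous such that for each ω ∈ Ω the function ℓ(·,ω) is convex, differentiable with L-Lipschitz gradient, and bounded below by M₀; symmetric positive definite matrices H_lb ⪯ H_ω ⪯ H_ub for each ω; D(·,ω) nonexpansive with respect to ‖·‖_{H_ω} for each ω; Fix(T(·,ω)) ∩ U nonempty for each ω; α, μ ∈ (0,1) and s ∈ (0, λ_min(H_lb)/L). Then: (i) for every ω ∈ Ω, dist(u^k(ω), Fix(T(·,ω)))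 → 0 and ℓ(u^k(ω),ω) → φ(ω) := inf{ℓ(u,ω) : u ∈ Fix(T(·,ω)) ∩ U} as k → ∞; and (ii) there exists C > 0 such that for every ω ∈ Ω and every k ≥ 2, ‖u^k(ω) − T(u^k(ω),ω)‖²_{H_lb} ≤ C·√((1 + ln(1+k))/k^{1/4}). -/
open scoped RealInnerProductSpace
open Filter Topology

lemma aux_grad_ineq {E : Type*} [NormedAddCommGroup E] [InnerProductSpace ℝ E] [CompleteSpace E]
    (f : E → ℝ) (hc : ConvexOn ℝ Set.univ f) (hd : Differentiable ℝ f) (x y : E) :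
    f x + ⟪gradient f x, y - x⟫ ≤ f y := by
  have h1 : ConvexOn ℝ Set.univ (fun t : ℝ => f (AffineMap.lineMap x y t)) := by
    have := hc.comp_affineMap (AffineMap.lineMap (k := ℝ) x y)
    rw [Set.preimage_univ] at this
    exact this
  have h2 : HasDerivAt (fun t : ℝ => f (AffineMap.lineMap x y t)) ⟪gradient f x, y - x⟫ 0 := by
    have hg := (hd x).hasGradientAt.hasFDerivAt
    have hl : HasDerivAt (fun t : ℝ => (AffineMap.lineMap x y t : E)) (y - x) 0 :=
      AffineMap.hasDerivAt_lineMap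
    have hg' : HasFDerivAt f ((InnerProductSpace.toDual ℝ E) (gradient f x))
      (AffineMap.lineMap x y (0:ℝ)) := by simpa using hg
    have := hg'.comp_hasDerivAt (0:ℝ) hl
    exact this
  have h3 := h1.le_slope_of_hasDerivAt (Set.mem_univ 0) (Set.mem_univ 1) one_pos h2
  rw [slope_def_field] at h3
  simp only [AffineMap.lineMap_apply_one, AffineMap.lineMap_apply_zero, sub_zero, div_one] at h3
  linarith

lemma aux_proj_vi {E : Type*} [NormedAddCommGroup E] [InnerProductSpace ℝ E]
    (V : Set E) (hV : Convex ℝ V) (z p : E) (hp : p ∈ V)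
    (h : ∀ w ∈ V, ‖p - z‖ ≤ ‖w - z‖) (w : E) (hw : w ∈ V) : ⟪z - p, w - p⟫ ≤ 0 := by
  refine (norm_eq_iInf_iff_real_inner_le_zero hV hp).1 ?_ w hw
  have : Nonempty V := ⟨⟨p, hp⟩⟩
  apply le_antisymm
  · refine le_ciInf fun w => ?_
    rw [norm_sub_rev z p, norm_sub_rev z]
    exact h w w.2
  · exact ciInf_le ⟨0, by rintro _ ⟨w, rfl⟩; positivity⟩ (⟨p, hp⟩ : V)

lemma aux_proj_ne {E : Type*} [NormedAddCommGroup E] [InnerProductSpace ℝ E]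
    (z₁ p₁ z₂ p₂ : E) (h1 : ⟪z₁ - p₁, p₂ - p₁⟫ ≤ 0) (h2 : ⟪z₂ - p₂, p₁ - p₂⟫ ≤ 0) :
    ‖p₁ - p₂‖ ≤ ‖z₁ - z₂‖ := by
  have e : z₁ - z₂ = (p₁ - p₂) + ((z₁ - p₁) - (z₂ - p₂)) := by abel
  have h3 : 0 ≤ ⟪p₁ - p₂, (z₁ - p₁) - (z₂ - p₂)⟫ := by
    rw [inner_sub_right, real_inner_comm, real_inner_comm (z₂ - p₂)]
    rw [← neg_sub p₁ p₂, inner_neg_right] at h1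
    linarith
  have h4 := norm_add_sq_real (p₁ - p₂) ((z₁ - p₁) - (z₂ - p₂))
  rw [← e] at h4
  refine le_of_sq_le_sq ?_ (norm_nonneg _) 
  nlinarith [sq_nonneg ‖(z₁ - p₁) - (z₂ - p₂)‖]

/-- basic one-step estimate -/
lemma aux_step {E : Type*} [NormedAddCommGroup E] [InnerProductSpace ℝ E]
    (x y h q x' : E) (t β G : ℝ) (ht : 0 ≤ t) (hβ : 0 < β) (hβ1 : β < 1)
    (hh : ‖h‖ ≤ G) (hy : ‖y - q‖ ≤ ‖x - q‖)
    (hx' : ‖x' - q‖ ≤ ‖(x - t • h + β • (y - x)) - q‖) :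
    ‖x' - q‖ ^ 2 ≤ ‖x - q‖ ^ 2 - β * (1 - β) / 2 * ‖y - x‖ ^ 2 - 2 * t * ⟪h, x - q⟫
      + (G ^ 2 * (1 + 2 * β / (1 - β))) * t ^ 2 := by
  have h1 : ‖x' - q‖ ^ 2 ≤ ‖(x - t • h + β • (y - x)) - q‖ ^ 2 := by gcongr
  set a := x - q with ha
  set r := y - x with hr
  have e1 : (x - t • h + β • r) - q = (a + β • r) - t • h := by simp only [ha, hr]; abel
  have e2 : y - q = a + r := by simp only [ha, hr]; abel
  rw [e1, norm_sub_sq_real (a + β • r), norm_add_sq_real, norm_smul, norm_smul, inner_smul_right,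
    inner_smul_right, inner_add_left, inner_smul_left] at h1
  have h2 : ‖y - q‖ ^ 2 ≤ ‖a‖ ^ 2 := by gcongr
  rw [e2, norm_add_sq_real] at h2
  simp only [Real.norm_eq_abs, mul_pow, sq_abs, conj_trivial] at h1
  have h3 : -⟪r, h⟫ ≤ ‖r‖ * G := by
    have := abs_real_inner_le_norm r h
    have h5 : ‖r‖ * ‖h‖ ≤ ‖r‖ * G := by gcongr
    linarith [neg_abs_le ⟪r, h⟫]
  have h4 : ‖h‖ ^ 2 ≤ G ^ 2 := by gcongr
  rw [real_inner_comm h a] at h1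
  have h6 : β * (2 * ⟪a, r⟫ + ‖r‖ ^ 2) ≤ 0 := by
    apply mul_nonpos_of_nonneg_of_nonpos hβ.le; linarith
  have h7 : (t * β) * (-⟪r, h⟫) ≤ (t * β) * (‖r‖ * G) := by gcongr
  have h8 : t ^ 2 * ‖h‖ ^ 2 ≤ t ^ 2 * G ^ 2 := by gcongr
  have h9 : 2 * t * β * G * ‖r‖ ≤ β * (1 - β) / 2 * ‖r‖ ^ 2 + 2 * β / (1 - β) * G ^ 2 * t ^ 2 := by
    have hp : 0 < 1 - β := by linarith
    have : β * (1 - β) / 2 * ‖r‖ ^ 2 + 2 * β / (1 - β) * G ^ 2 * t ^ 2 - 2 * t * β * G * ‖r‖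
      = β / (2 * (1 - β)) * ((1 - β) * ‖r‖ - 2 * G * t) ^ 2 := by field_simp; ring
    have h10 : 0 ≤ β / (2 * (1 - β)) * ((1 - β) * ‖r‖ - 2 * G * t) ^ 2 := by positivity
    linarith
  nlinarith

lemma aux_compact {E : Type*} [TopologicalSpace E] (U : Set E) (hU : IsCompact U)
    (F G : E → ℝ) (hF : Continuous F) (hG : Continuous G) (hF0 : ∀ x, 0 ≤ F x)
    (h : ∀ x ∈ U, F x = 0 → G x ≤ 0) (ε : ℝ) (hε : 0 < ε) :
    ∃ δ > 0, ∀ x ∈ U, ε ≤ G x → δ ≤ F x := by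
  have hK : IsCompact (U ∩ {x | ε ≤ G x}) := hU.inter_right (isClosed_le continuous_const hG)
  rcases (U ∩ {x | ε ≤ G x}).eq_empty_or_nonempty with he | hne
  · refine ⟨1, one_pos, fun x hx hx' => ?_⟩
    have : x ∈ U ∩ {x | ε ≤ G x} := ⟨hx, hx'⟩
    rw [he] at this; exact this.elim
  · obtain ⟨x0, hx0, hm⟩ := hK.exists_isMinOn hne hF.continuousOn
    refine ⟨F x0, lt_of_le_of_ne (hF0 _) (fun h0 => ?_), fun x hx hx' => hm ⟨hx, hx'⟩⟩
    have := h x0 hx0.1 h0.symm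
    have h2 : ε ≤ G x0 := hx0.2
    linarith

lemma aux_compact_tendsto {E : Type*} [TopologicalSpace E] (U : Set E) (hU : IsCompact U)
    (F G : E → ℝ) (hF : Continuous F) (hG : Continuous G) (hF0 : ∀ x, 0 ≤ F x)
    (h : ∀ x ∈ U, F x = 0 → G x = 0) (x : ℕ → E) (hx : ∀ k, x k ∈ U)
    (hl : Tendsto (fun k => F (x k)) atTop (𝓝 0)) : Tendsto (fun k => G (x k)) atTop (𝓝 0) := by
  rw [Metric.tendsto_atTop]
  intro ε hε
  obtain ⟨δ, hδ, hh⟩ := aux_compact U hU F (fun x => |G x|) hF hG.abs hF0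
    (fun x hx h0 => by rw [h x hx h0, abs_zero]) ε hε
  obtain ⟨N, hN⟩ := (hl.eventually_lt_const hδ).exists_forall_of_atTop
  refine ⟨N, fun k hk => ?_⟩
  rw [Real.dist_eq, sub_zero]
  by_contra hcon
  exact absurd (hh (x k) (hx k) (not_lt.1 hcon)) (not_le.2 (hN k hk))

lemma aux_quasi (b v : ℕ → ℝ) (t K M : ℝ) (ht : 0 < t) (hb : ∀ k, 0 ≤ b k)
    (hv : ∀ k, -v k ≤ M)
    (hs : ∀ k : ℕ, b (k + 1) ≤ b k - 2 * (t / (k + 1)) * v k + K * (t / (k + 1)) ^ 2)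
    (hδ : ∀ ε > 0, ∃ δ > 0, ∃ N, ∀ k ≥ N, ε ≤ b k → δ ≤ v k) :
    Tendsto b atTop (𝓝 0) := by
  have htl : Tendsto (fun k : ℕ => t / ((k : ℝ) + 1)) atTop (𝓝 0) := by
    have := (tendsto_one_div_add_atTop_nhds_zero_nat (𝕜 := ℝ)).const_mul t
    simpa [div_eq_mul_inv] using this
  have htp : ∀ k : ℕ, 0 < t / ((k : ℝ) + 1) := fun k => by positivity
  have key : ∀ ε > 0, ∃ k0, ∀ k ≥ k0, b k ≤ 2 * ε := by
    intro ε hε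
    obtain ⟨δ, hδ0, N, hN⟩ := hδ ε hε
    have c1 : Tendsto (fun k : ℕ => K * (t / ((k : ℝ) + 1))) atTop (𝓝 0) := by
      simpa using htl.const_mul K
    have c2 : Tendsto (fun k : ℕ => 2 * M * (t / ((k : ℝ) + 1)) + K * (t / ((k : ℝ) + 1)) ^ 2)
      atTop (𝓝 0) := by simpa using (htl.const_mul (2 * M)).add ((htl.pow 2).const_mul K)
    obtain ⟨N', hN'⟩ := ((c1.eventually_lt_const hδ0).and
      (c2.eventually_lt_const hε)).exists_forall_of_atTop
    have hdec : ∀ k, N ≤ k → N' ≤ k → ε ≤ b k → b (k + 1) ≤ b k - δ * (t / ((k : ℝ) + 1)) := by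
      intro k h1 h2 h3
      have a1 := hN k h1 h3
      have a2 := (hN' k h2).1
      have a3 := hs k
      have a4 := htp k
      set τ := t / ((k : ℝ) + 1)
      have a5 : K * τ * τ ≤ δ * τ := by gcongr
      have a6 : τ * δ ≤ τ * v k := by gcongr
      nlinarith
    have hex : ∃ k0, N ≤ k0 ∧ N' ≤ k0 ∧ b k0 < ε := by
      by_contra! hcon
      set P := max N N'
      have hsum : ∀ j : ℕ, b (P + j) ≤ b P - δ * ∑ i ∈ Finset.range j, t / (((P + i : ℕ) : ℝ) + 1) := by
        intro j
        induction j with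
        | zero => simp
        | succ j ih =>
          have l1 : N ≤ P + j := (le_max_left _ _).trans (Nat.le_add_right _ _)
          have l2 : N' ≤ P + j := (le_max_right _ _).trans (Nat.le_add_right _ _)
          have := hdec (P + j) l1 l2 (hcon _ l1 l2)
          rw [Finset.sum_range_succ, ← add_assoc, mul_add]
          linarith
      have hdiv : Tendsto (fun j => ∑ i ∈ Finset.range j, t / (((P + i : ℕ) : ℝ) + 1)) atTop atTop := by
        have h0 := Real.tendsto_sum_range_one_div_nat_succ_atTop
        have h1 : ¬ Summable (fun i : ℕ => 1 / ((i : ℝ) + 1)) := by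
          rw [not_summable_iff_tendsto_nat_atTop_of_nonneg (fun i => by positivity)]
          exact h0
        rw [← summable_nat_add_iff P] at h1
        rw [not_summable_iff_tendsto_nat_atTop_of_nonneg (fun i => by positivity)] at h1
        refine (h1.const_mul_atTop ht).congr fun j => ?_
        rw [Finset.mul_sum]
        refine Finset.sum_congr rfl fun i _ => ?_
        push_cast
        rw [mul_one_div, add_comm (i : ℝ)]
      obtain ⟨j, hj⟩ := (hdiv.eventually_gt_atTop (b P / δ)).exists
      have := hsum j
      rw [div_lt_iff₀ hδ0] at hj
      have := hb (P + j)
      linarith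
    obtain ⟨k0, h1, h2, h3⟩ := hex
    refine ⟨k0, fun k hk => ?_⟩
    induction k, hk using Nat.le_induction with
    | base => linarith
    | succ k hk ih =>
      rcases lt_or_ge (b k) ε with hlt | hge
      · have a2 := (hN' k (h2.trans hk)).2
        have a3 := hs k
        have a4 := htp k
        have a6 := mul_le_mul_of_nonneg_left (hv k) a4.le
        nlinarith
      · have := hdec k (h1.trans hk) (h2.trans hk) hge
        have a4 := mul_pos hδ0 (htp k)
        linarith
  rw [Metric.tendsto_atTop]
  intro ε hε
  obtain ⟨k0, hk0⟩ := key (ε / 4) (by positivity)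
  refine ⟨k0, fun k hk => ?_⟩
  rw [Real.dist_eq, sub_zero, abs_of_nonneg (hb k)]
  linarith [hk0 k hk]
lemma aux_harm (k : ℕ) : ∑ j ∈ Finset.range k, 1 / ((j : ℝ) + 1) ≤ 1 + Real.log k := by
  have := harmonic_le_one_add_log k
  simpa [harmonic] using this

set_option maxHeartbeats 1000000 in
lemma aux_rate (c K : ℝ) (hc : 0 < c) (hK : 0 < K) : ∃ C > 0, ∀ a d r : ℕ → ℝ,
    (∀ k, 0 ≤ a k) → (∀ k, 0 ≤ d k) → (∀ k, 0 ≤ r k) → a 0 ≤ K →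
    (∀ k : ℕ, a (k + 1) ≤ a k - c * r k ^ 2 + K / (k + 1)) →
    (∀ k, a k - a (k + 1) ≤ K * d k) →
    (∀ k : ℕ, d k ≤ r k + K / (k + 1)) →
    (∀ k : ℕ, d (k + 1) ≤ d k + K / (k + 1)) →
    ∀ k : ℕ, 2 ≤ k → r k ^ 2 ≤
      C * Real.sqrt ((1 + Real.log (1 + (k : ℝ))) / (k : ℝ) ^ ((1 : ℝ) / 4)) := by
  set C1 : ℝ := 2 * (2 * K / c) + 2 * K ^ 2 with hC1
  set C2 : ℝ := 2 * C1 + 8 * K ^ 2 with hC2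
  have hC1p : 0 < C1 := by positivity
  have hC2p : 0 < C2 := by positivity
  refine ⟨(K * Real.sqrt C2 + K) / c, by positivity, ?_⟩
  intro a d r ha hd hr ha0 hstep hdiff hdr hdd k hk
  have hk0 : (0:ℝ) < k := by positivity
  have hk1 : (1:ℝ) ≤ k := by exact_mod_cast (by omega : 1 ≤ k)
  have hlog : 0 ≤ Real.log (1 + (k:ℝ)) := Real.log_nonneg (by linarith)
  set X := 1 + Real.log (1 + (k:ℝ)) with hX
  have hX1 : 1 ≤ X := by linarith
  -- telescoping
  have htel : ∀ N : ℕ, c * ∑ j ∈ Finset.range N, r j ^ 2 ≤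
      a 0 - a N + K * ∑ j ∈ Finset.range N, 1 / ((j : ℝ) + 1) := by
    intro N
    induction N with
    | zero => simp
    | succ N ih =>
      rw [Finset.sum_range_succ, Finset.sum_range_succ, mul_add, mul_add, mul_one_div]
      linarith [hstep N]
  have hH : ∑ j ∈ Finset.range (k + 1), 1 / ((j : ℝ) + 1) ≤ X := by
    have := aux_harm (k + 1)
    push_cast at this
    rw [add_comm (k:ℝ)] at this
    exact this
  have hsumr : ∑ j ∈ Finset.range (k + 1), r j ^ 2 ≤ 2 * K / c * X := by
    have h1 := htel (k + 1)
    have h2 : K * ∑ j ∈ Finset.range (k + 1), 1 / ((j : ℝ) + 1) ≤ K * X := by gcongr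
    have h3 := ha (k + 1)
    have h4 : K * 1 ≤ K * X := by gcongr
    rw [div_mul_eq_mul_div, le_div_iff₀ hc]
    linarith
  have hsumd : ∑ j ∈ Finset.range (k + 1), d j ^ 2 ≤ C1 * X := by
    have h1 : ∑ j ∈ Finset.range (k + 1), d j ^ 2 ≤
        ∑ j ∈ Finset.range (k + 1), (2 * r j ^ 2 + 2 * K ^ 2 * (1 / ((j : ℝ) + 1))) := by
      refine Finset.sum_le_sum fun j _ => ?_
      have e0 : d j ^ 2 ≤ (r j + K / (j + 1)) ^ 2 := by
        have := hdr j
        have := hd j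
        gcongr
      have e1 : (1 / ((j:ℝ) + 1)) ^ 2 ≤ 1 / ((j:ℝ) + 1) := by
        have h0 : 0 ≤ 1 / ((j:ℝ) + 1) := by positivity
        have h1 : 1 / ((j:ℝ) + 1) ≤ 1 := by
          rw [div_le_one (by positivity)]
          have : (0:ℝ) ≤ j := by positivity
          linarith
        nlinarith
      have e2 : (K / ((j:ℝ) + 1)) ^ 2 = K ^ 2 * (1 / ((j:ℝ) + 1)) ^ 2 := by
        rw [← mul_pow, mul_one_div]
      have e3 : K ^ 2 * (1 / ((j:ℝ) + 1)) ^ 2 ≤ K ^ 2 * (1 / ((j:ℝ) + 1)) := by gcongr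
      nlinarith [sq_nonneg (r j - K / ((j:ℝ) + 1))]
    rw [Finset.sum_add_distrib, ← Finset.mul_sum, ← Finset.mul_sum] at h1
    have h2 : K ^ 2 * ∑ j ∈ Finset.range (k + 1), 1 / ((j : ℝ) + 1) ≤ K ^ 2 * X := by gcongr
    rw [hC1, add_mul]
    linarith
  -- window
  set w := Nat.sqrt k with hw
  have hwk : w ≤ k := Nat.sqrt_le_self k
  have hw1 : w * w ≤ k := Nat.sqrt_le k
  have hw2 : k < (w + 1) * (w + 1) := Nat.lt_succ_sqrt k
  have hw1R : (w:ℝ) ^ 2 ≤ k := by rw [sq]; exact_mod_cast hw1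
  have hw2R : (k:ℝ) ≤ ((w:ℝ) + 1) ^ 2 := by rw [sq]; exact_mod_cast hw2.le
  have hdown : ∀ i : ℕ, i ≤ w → d k ≤ d (k - i) + i * (2 * K / k) := by
    intro i
    induction i with
    | zero => simp
    | succ i ih =>
      intro hi
      have h1 := ih (by omega)
      have h2 := hdd (k - (i + 1))
      have e : k - (i + 1) + 1 = k - i := by omega
      rw [e] at h2
      have h3 : K / (((k - (i + 1) : ℕ) : ℝ) + 1) ≤ 2 * K / k := by
        have : (k:ℝ) / 2 ≤ ((k - (i + 1) : ℕ) : ℝ) + 1 := by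
          rw [Nat.cast_sub (by omega)]
          push_cast
          have : (i:ℝ) + 1 ≤ w := by exact_mod_cast hi
          nlinarith [sq_nonneg ((w:ℝ) - 1)]
        rw [div_le_div_iff₀ (by positivity) hk0]
        nlinarith
      push_cast
      linarith
  have hdk : d k ^ 2 ≤ C2 * (X / Real.sqrt k) := by
    have hcard : ((w:ℝ) + 1) * d k ^ 2 ≤ 2 * (C1 * X) + ((w:ℝ) + 1) * (8 * K ^ 2 / k) := by
      have h1 : ∑ j ∈ Finset.Ico (k - w) (k + 1), d k ^ 2 ≤
          ∑ j ∈ Finset.Ico (k - w) (k + 1), (2 * d j ^ 2 + 8 * K ^ 2 / k) := by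
        refine Finset.sum_le_sum fun j hj => ?_
        rw [Finset.mem_Ico] at hj
        have h2 := hdown (k - j) (by omega)
        rw [show k - (k - j) = j by omega] at h2
        have h3 : ((k - j : ℕ) : ℝ) ≤ w := by exact_mod_cast (by omega : k - j ≤ w)
        have h4 : d k ≤ d j + w * (2 * K / k) := by
          refine h2.trans ?_
          gcongr
        have h5 : d k ^ 2 ≤ (d j + w * (2 * K / k)) ^ 2 := by
          have := hd k
          gcongr
        have h6 : (w * (2 * K / k)) ^ 2 ≤ 4 * K ^ 2 / k := by
          have : (w * (2 * K / (k:ℝ))) ^ 2 = (w:ℝ) ^ 2 * (4 * K ^ 2 / (k:ℝ) ^ 2) := by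
            field_simp; ring
          rw [this]
          calc (w:ℝ) ^ 2 * (4 * K ^ 2 / (k:ℝ) ^ 2) ≤ k * (4 * K ^ 2 / (k:ℝ) ^ 2) := by gcongr
            _ = _ := by field_simp
        have h7 : 8 * K ^ 2 / (k:ℝ) = 2 * (4 * K ^ 2 / k) := by ring
        nlinarith [sq_nonneg (d j - w * (2 * K / k))]
      rw [Finset.sum_const, Finset.sum_add_distrib, Finset.sum_const, Nat.card_Ico,
        ← Finset.mul_sum, show k + 1 - (k - w) = w + 1 by omega, nsmul_eq_mul, nsmul_eq_mul] at h1
      have h8 : ∑ j ∈ Finset.Ico (k - w) (k + 1), d j ^ 2 ≤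
          ∑ j ∈ Finset.range (k + 1), d j ^ 2 := by
        apply Finset.sum_le_sum_of_subset_of_nonneg
        · intro j hj
          rw [Finset.mem_Ico] at hj
          exact Finset.mem_range.2 hj.2
        · intros; positivity
      push_cast at h1
      linarith
    have hsq : Real.sqrt k ≤ (w:ℝ) + 1 := by
      rw [Real.sqrt_le_left (by positivity)]
      exact hw2R
    have hsp : 0 < Real.sqrt k := Real.sqrt_pos.2 hk0
    have hsk : 8 * K ^ 2 / (k:ℝ) ≤ 8 * K ^ 2 * (X / Real.sqrt k) := by
      rw [div_eq_mul_one_div]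
      have : 1 / (k:ℝ) ≤ X / Real.sqrt k := by
        have : Real.sqrt k ≤ k := by
          rw [Real.sqrt_le_left (by positivity)]
          nlinarith
        gcongr
      gcongr
    have hw0 : (0:ℝ) < (w:ℝ) + 1 := by positivity
    have hq : d k ^ 2 ≤ 2 * (C1 * X) / ((w:ℝ) + 1) + 8 * K ^ 2 / k := by
      rw [← sub_le_iff_le_add, le_div_iff₀ hw0]
      nlinarith
    have hq2 : 2 * (C1 * X) / ((w:ℝ) + 1) ≤ 2 * (C1 * X) / Real.sqrt k := by gcongr
    calc d k ^ 2 ≤ 2 * (C1 * X) / Real.sqrt k + 8 * K ^ 2 * (X / Real.sqrt k) := by linarith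
      _ = _ := by rw [hC2]; ring
  set Y := X / (k:ℝ) ^ ((1:ℝ)/4) with hY
  have hkq : 0 < (k:ℝ) ^ ((1:ℝ)/4) := by positivity
  have hY1 : X / Real.sqrt k ≤ Y := by
    rw [hY, Real.sqrt_eq_rpow]
    have : (k:ℝ) ^ ((1:ℝ)/4) ≤ (k:ℝ) ^ ((1:ℝ)/2) :=
      Real.rpow_le_rpow_of_exponent_le hk1 (by norm_num)
    gcongr
  have hY0 : 0 ≤ Y := by positivity
  have hd1 : d k ≤ Real.sqrt C2 * Real.sqrt Y := by
    rw [← Real.sqrt_mul hC2p.le]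
    apply Real.le_sqrt_of_sq_le
    refine hdk.trans ?_
    gcongr
  have hy2 : 1 / ((k:ℝ) + 1) ≤ Real.sqrt Y := by
    apply Real.le_sqrt_of_sq_le
    have e1 : (k:ℝ) ^ ((1:ℝ)/4) ≤ k := by
      calc (k:ℝ) ^ ((1:ℝ)/4) ≤ (k:ℝ) ^ (1:ℝ) :=
            Real.rpow_le_rpow_of_exponent_le hk1 (by norm_num)
        _ = k := Real.rpow_one _
    rw [hY, div_pow, one_pow]
    have e2 : (k:ℝ) ^ ((1:ℝ)/4) ≤ ((k:ℝ) + 1) ^ 2 := by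
      have e3 : ((k:ℝ) + 1) ^ 2 = (k:ℝ) ^ 2 + 2 * k + 1 := by ring
      linarith [sq_nonneg (k:ℝ)]
    gcongr
  have h1 := hstep k
  have h2 := hdiff k
  rw [div_mul_eq_mul_div, le_div_iff₀ hc]
  have h3 : K * d k ≤ K * (Real.sqrt C2 * Real.sqrt Y) := by gcongr
  have h4 : K / ((k:ℝ) + 1) ≤ K * Real.sqrt Y := by
    rw [div_eq_mul_one_div]; gcongr
  linarith

/-- uniform rate, vector version -/
lemma aux_vec_rate {E : Type*} [NormedAddCommGroup E] [InnerProductSpace ℝ E]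
    (t β G M R : ℝ) (ht : 0 < t) (hβ : 0 < β) (hβ1 : β < 1) (hG : 0 ≤ G) (hM : 0 ≤ M)
    (hR : 0 < R) : ∃ C > 0, ∀ (V : Set E) (x y h : ℕ → E) (q : E), q ∈ V → (∀ k, x k ∈ V) →
    (∀ v ∈ V, ∀ w ∈ V, ‖v - w‖ ≤ R) →
    (∀ k : ℕ, ∀ v ∈ V, ⟪(x k - (t / ((k:ℝ) + 1)) • h k + β • (y k - x k)) - x (k + 1),
        v - x (k + 1)⟫ ≤ 0) →
    (∀ k, ‖y k - q‖ ≤ ‖x k - q‖) → (∀ k, ‖y (k + 1) - y k‖ ≤ ‖x (k + 1) - x k‖) →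
    (∀ k, ‖h k‖ ≤ G) → (∀ k, -⟪h k, x k - q⟫ ≤ M) →
    ∀ k : ℕ, 2 ≤ k → ‖y k - x k‖ ^ 2 ≤
      C * Real.sqrt ((1 + Real.log (1 + (k : ℝ))) / (k : ℝ) ^ ((1 : ℝ) / 4)) := by
  set K1 := G ^ 2 * (1 + 2 * β / (1 - β)) with hK1
  have h1β : 0 < 1 - β := by linarith
  have hK1p : 0 ≤ K1 := by positivity
  set K := R ^ 2 + (2 * t * M + K1 * t ^ 2) + 2 * R + 2 * t * G with hK
  have hKp : 0 < K := by positivity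
  obtain ⟨C, hC, hmain⟩ := aux_rate (β * (1 - β) / 2) K (by positivity) hKp
  refine ⟨C, hC, ?_⟩
  intro V x y h q hq hx hdiam hvi hyq hyy hh hinn
  have hτ : ∀ k : ℕ, 0 < t / ((k:ℝ) + 1) := fun k => by positivity
  refine hmain (fun k => ‖x k - q‖ ^ 2) (fun k => ‖x (k + 1) - x k‖) (fun k => ‖y k - x k‖)
    (fun k => by positivity) (fun k => by positivity) (fun k => by positivity) ?_ ?_ ?_ ?_ ?_
  · have : ‖x 0 - q‖ ^ 2 ≤ R ^ 2 := by
      have := hdiam _ (hx 0) _ hq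
      gcongr
    refine this.trans ?_
    have : 0 ≤ (2 * t * M + K1 * t ^ 2) + 2 * R + 2 * t * G := by positivity
    linarith
  · intro k
    have hp : ‖x (k + 1) - q‖ ≤ ‖(x k - (t / ((k:ℝ) + 1)) • h k + β • (y k - x k)) - q‖ :=
      aux_proj_ne _ _ q q (hvi k q hq) (by simp)
    have h1 := aux_step (x k) (y k) (h k) q (x (k + 1)) _ β G (hτ k).le hβ hβ1 (hh k) (hyq k) hp
    have h2 : (t / ((k:ℝ) + 1)) * (-⟪h k, x k - q⟫) ≤ (t / ((k:ℝ) + 1)) * M :=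
      mul_le_mul_of_nonneg_left (hinn k) (hτ k).le
    have h3 : (t / ((k:ℝ) + 1)) ^ 2 ≤ t ^ 2 / ((k:ℝ) + 1) := by
      rw [div_pow]
      have : (k:ℝ) + 1 ≤ ((k:ℝ) + 1) ^ 2 := by nlinarith [(Nat.cast_nonneg k : (0:ℝ) ≤ k)]
      gcongr
    have h4 : K1 * (t / ((k:ℝ) + 1)) ^ 2 ≤ K1 * (t ^ 2 / ((k:ℝ) + 1)) := by gcongr
    have h5 : 2 * ((t / ((k:ℝ) + 1)) * M) + K1 * (t ^ 2 / ((k:ℝ) + 1)) ≤ K / ((k:ℝ) + 1) := by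
      have : 2 * ((t / ((k:ℝ) + 1)) * M) + K1 * (t ^ 2 / ((k:ℝ) + 1)) =
        (2 * t * M + K1 * t ^ 2) / ((k:ℝ) + 1) := by ring
      rw [this]
      have : 0 ≤ R ^ 2 + 2 * R + 2 * t * G := by positivity
      gcongr
      linarith
    linarith
  · intro k
    have h1 := hdiam _ (hx k) _ hq
    have h2 := hdiam _ (hx (k + 1)) _ hq
    have h3 : ‖x k - q‖ - ‖x (k + 1) - q‖ ≤ ‖x (k + 1) - x k‖ := by
      have := norm_sub_norm_le (x k - q) (x (k + 1) - q)
      rw [sub_sub_sub_cancel_right, norm_sub_rev (x k) (x (k + 1))] at this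
      exact this
    have h4 : ‖x k - q‖ ^ 2 - ‖x (k + 1) - q‖ ^ 2 ≤ 2 * R * ‖x (k + 1) - x k‖ := by
      have n1 := norm_nonneg (x k - q)
      have n2 := norm_nonneg (x (k+1) - q)
      have n3 := norm_nonneg (x (k+1) - x k)
      calc ‖x k - q‖ ^ 2 - ‖x (k + 1) - q‖ ^ 2
          = (‖x k - q‖ + ‖x (k + 1) - q‖) * (‖x k - q‖ - ‖x (k + 1) - q‖) := by ring
        _ ≤ (‖x k - q‖ + ‖x (k + 1) - q‖) * ‖x (k + 1) - x k‖ := by gcongr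
        _ ≤ (R + R) * ‖x (k + 1) - x k‖ := by gcongr
        _ = _ := by ring
    refine h4.trans ?_
    have : 0 ≤ R ^ 2 + (2 * t * M + K1 * t ^ 2) + 2 * t * G := by positivity
    gcongr
    linarith
  · intro k
    have hp : ‖x (k + 1) - x k‖ ≤ ‖(x k - (t / ((k:ℝ) + 1)) • h k + β • (y k - x k)) - x k‖ :=
      aux_proj_ne _ _ (x k) (x k) (hvi k _ (hx k)) (by simp)
    have e : (x k - (t / ((k:ℝ) + 1)) • h k + β • (y k - x k)) - x k =
      β • (y k - x k) - (t / ((k:ℝ) + 1)) • h k := by abel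
    rw [e] at hp
    have h1 := norm_sub_le (β • (y k - x k)) ((t / ((k:ℝ) + 1)) • h k)
    rw [norm_smul, norm_smul, Real.norm_of_nonneg hβ.le, Real.norm_of_nonneg (hτ k).le] at h1
    have h2 : β * ‖y k - x k‖ ≤ 1 * ‖y k - x k‖ := by gcongr
    have h3 : t / ((k:ℝ) + 1) * ‖h k‖ ≤ t / ((k:ℝ) + 1) * G := by
      have := hh k
      have := hτ k
      gcongr
    have h4 : t / ((k:ℝ) + 1) * G ≤ K / ((k:ℝ) + 1) := by
      rw [div_mul_eq_mul_div]
      have : 0 ≤ R ^ 2 + (2 * t * M + K1 * t ^ 2) + 2 * R + t * G := by positivity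
      gcongr
      linarith
    linarith
  · intro k
    have hp := aux_proj_ne _ _ _ _ (hvi (k + 1) _ (hx (k + 1))) (hvi k _ (hx (k + 1 + 1)))
    have e : (x (k + 1) - (t / (((k + 1 : ℕ):ℝ) + 1)) • h (k + 1) + β • (y (k + 1) - x (k + 1))) -
       (x k - (t / ((k:ℝ) + 1)) • h k + β • (y k - x k)) =
       ((1 - β) • (x (k + 1) - x k) + β • (y (k + 1) - y k)) +
       ((t / ((k:ℝ) + 1)) • h k - (t / (((k + 1 : ℕ):ℝ) + 1)) • h (k + 1)) := by module
    rw [e] at hp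
    have h1 := norm_add_le ((1 - β) • (x (k + 1) - x k) + β • (y (k + 1) - y k))
       ((t / ((k:ℝ) + 1)) • h k - (t / (((k + 1 : ℕ):ℝ) + 1)) • h (k + 1))
    have h2 := norm_add_le ((1 - β) • (x (k + 1) - x k)) (β • (y (k + 1) - y k))
    have h3 := norm_sub_le ((t / ((k:ℝ) + 1)) • h k) ((t / (((k + 1 : ℕ):ℝ) + 1)) • h (k + 1))
    rw [norm_smul, norm_smul, Real.norm_of_nonneg hβ.le, Real.norm_of_nonneg h1β.le] at h2
    rw [norm_smul, norm_smul, Real.norm_of_nonneg (hτ k).le,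
      Real.norm_of_nonneg (hτ (k + 1)).le] at h3
    have h4 : β * ‖y (k + 1) - y k‖ ≤ β * ‖x (k + 1) - x k‖ := by
      have := hyy k
      gcongr
    have h5 : t / ((k:ℝ) + 1) * ‖h k‖ ≤ t / ((k:ℝ) + 1) * G := by
      have := hh k
      have := hτ k
      gcongr
    have h6 : t / (((k + 1 : ℕ):ℝ) + 1) * ‖h (k + 1)‖ ≤ t / ((k:ℝ) + 1) * G := by
      have := hh (k + 1)
      have := hτ k
      have : (k:ℝ) + 1 ≤ ((k + 1 : ℕ):ℝ) + 1 := by push_cast; linarith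
      gcongr
    have h7 : 2 * (t / ((k:ℝ) + 1) * G) ≤ K / ((k:ℝ) + 1) := by
      have : 2 * (t / ((k:ℝ) + 1) * G) = (2 * t * G) / ((k:ℝ) + 1) := by ring
      rw [this]
      have : 0 ≤ R ^ 2 + (2 * t * M + K1 * t ^ 2) + 2 * R := by positivity
      gcongr
      linarith
    linarith

lemma aux_conv {E : Type*} [NormedAddCommGroup E] [InnerProductSpace ℝ E]
    (U : Set E) (hU : IsCompact U) (A : E →L[ℝ] E) (c0 : ℝ) (hc0 : 0 < c0)
    (hA : ∀ x, c0 * ‖x‖ ≤ ‖A x‖) (D : E → E)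
    (hD : ∀ x y, ‖A (D x - D y)‖ ≤ ‖A (x - y)‖) (f : E → ℝ) (hf : Continuous f)
    (g : E → E) (hg : ∀ x y, f x + ⟪g x, y - x⟫ ≤ f y)
    (hF : ({x | D x = x} ∩ U).Nonempty)
    (u w : ℕ → E) (hu : ∀ k, u k ∈ U) (hw : ∀ k x, ⟪A (w k), A x⟫ = ⟪g (u k), x⟫)
    (t β G M : ℝ) (ht : 0 < t) (hβ : 0 < β) (hβ1 : β < 1)
    (hG : ∀ k, ‖A (w k)‖ ≤ G) (hM : ∀ x ∈ U, ∀ y ∈ U, f x - f y ≤ M)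
    (hvi : ∀ k : ℕ, ∀ v ∈ U, ⟪A ((u k - (t / ((k:ℝ) + 1)) • w k + β • (D (u k) - u k))
        - u (k + 1)), A (v - u (k + 1))⟫ ≤ 0)
    (hres : Tendsto (fun k => ‖A (D (u k) - u k)‖) atTop (𝓝 0)) :
    Tendsto (fun k => Metric.infDist (u k) {x | D x = x}) atTop (𝓝 0) ∧
    Tendsto (fun k => f (u k)) atTop (𝓝 (sInf (f '' ({x | D x = x} ∩ U)))) := by
  have hA0 : ∀ x, A x = 0 → x = 0 := by
    intro x hx
    have := hA x
    rw [hx, norm_zero] at this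
    have h2 : ‖x‖ ≤ 0 := by
      by_contra! hcon
      have := mul_pos hc0 hcon
      linarith
    exact norm_le_zero_iff.1 h2
  have hDc : Continuous D := by
    have hl : LipschitzWith (‖A‖ / c0).toNNReal D := by
      apply LipschitzWith.of_dist_le_mul
      intro x y
      rw [dist_eq_norm, dist_eq_norm, Real.coe_toNNReal _ (by positivity), div_mul_eq_mul_div,
        le_div_iff₀ hc0, mul_comm]
      exact (hA _).trans ((hD x y).trans (A.le_opNorm _))
    exact hl.continuous
  have hrc : Continuous fun x => ‖A (D x - x)‖ := by fun_prop
  have hr0 : ∀ x, ‖A (D x - x)‖ = 0 → D x = x := by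
    intro x hx
    exact sub_eq_zero.1 (hA0 _ (norm_eq_zero.1 hx))
  have hFcl : IsClosed {x | D x = x} := isClosed_eq hDc continuous_id
  constructor
  · refine aux_compact_tendsto U hU _ (fun x => Metric.infDist x {x | D x = x}) hrc
      (Metric.continuous_infDist_pt _) (fun x => norm_nonneg _) ?_ u hu hres
    intro x _ hx0
    exact Metric.infDist_zero_of_mem (hr0 x hx0)
  have hFK : IsCompact ({x | D x = x} ∩ U) := hU.inter_left hFcl
  obtain ⟨p0, hp0, hpm⟩ := hFK.exists_isMinOn hF hf.continuousOn
  have hpm' : ∀ x ∈ {x | D x = x} ∩ U, f p0 ≤ f x := fun x hx => hpm hx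
  have hinf : sInf (f '' ({x | D x = x} ∩ U)) = f p0 := by
    apply IsLeast.csInf_eq
    refine ⟨⟨p0, hp0, rfl⟩, ?_⟩
    rintro _ ⟨x, hx, rfl⟩
    exact hpm' x hx
  rw [hinf]
  set φ := f p0 with hφ
  set S := ({x | D x = x} ∩ U) ∩ {x | f x ≤ φ} with hS
  have hSK : IsCompact S := hFK.inter_right (isClosed_le hf continuous_const)
  have hSne : S.Nonempty := ⟨p0, hp0, le_refl (f p0)⟩
  have hASK : IsCompact (A '' S) := hSK.image A.continuous
  have hASne : (A '' S).Nonempty := hSne.image _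
  set b : E → ℝ := fun x => Metric.infDist (A x) (A '' S) ^ 2 with hb
  have hbc : Continuous b := ((Metric.continuous_infDist_pt _).comp A.continuous).pow 2
  have hb0 : ∀ x, 0 ≤ b x := fun x => sq_nonneg _
  have hbS : ∀ x ∈ S, b x = 0 := by
    intro x hx
    have := Metric.infDist_zero_of_mem (Set.mem_image_of_mem A hx)
    simp only [hb, this]; norm_num
  have hSb : ∀ x, b x = 0 → x ∈ S := by
    intro x hx
    have h1 : Metric.infDist (A x) (A '' S) = 0 := by simpa [hb] using hx
    have h2 := (hASK.isClosed.mem_iff_infDist_zero hASne).2 h1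
    obtain ⟨y, hy, hyx⟩ := h2
    have : y - x = 0 := hA0 _ (by rw [map_sub, hyx, sub_self])
    rw [← sub_eq_zero.1 this]; exact hy
  have hblim : Tendsto (fun k => b (u k)) atTop (𝓝 0) := by
    refine aux_quasi (fun k => b (u k)) (fun k => f (u k) - φ) t
      (G ^ 2 * (1 + 2 * β / (1 - β))) M ht (fun k => hb0 _) ?_ ?_ ?_
    · intro k
      have := hM p0 hp0.2 (u k) (hu k)
      linarith
    · intro k
      obtain ⟨q, hq, hqd⟩ := hASK.exists_infDist_eq_dist hASne (A (u k))
      obtain ⟨p, hp, rfl⟩ := hq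
      have hτ : 0 < t / ((k:ℝ) + 1) := by positivity
      have hpr : ‖A (u (k + 1)) - A p‖ ≤
          ‖(A (u k) - (t / ((k:ℝ) + 1)) • A (w k) + β • (A (D (u k)) - A (u k))) - A p‖ := by
        refine aux_proj_ne _ _ (A p) (A p) ?_ (by simp)
        have := hvi k p hp.1.2
        simpa only [map_sub, map_add, map_smul] using this
      have hDp : D p = p := hp.1.1
      have hy : ‖A (D (u k)) - A p‖ ≤ ‖A (u k) - A p‖ := by
        have := hD (u k) p
        rwa [hDp, map_sub, map_sub] at this
      have h1 := aux_step (A (u k)) (A (D (u k))) (A (w k)) (A p) (A (u (k + 1))) _ β G hτ.le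
        hβ hβ1 (hG k) hy hpr
      rw [← map_sub A (u k) p, hw k, map_sub, ← dist_eq_norm (A (u k)), ← hqd] at h1
      have h2 : b (u (k + 1)) ≤ ‖A (u (k + 1)) - A p‖ ^ 2 := by
        have h3 := Metric.infDist_le_dist_of_mem (x := A (u (k + 1))) (Set.mem_image_of_mem A hp)
        rw [dist_eq_norm] at h3
        have h4 : 0 ≤ Metric.infDist (A (u (k + 1))) (A '' S) := Metric.infDist_nonneg
        simp only [hb]
        gcongr
      have h5 : f (u k) - φ ≤ ⟪g (u k), u k - p⟫ := by
        have h6 := hg (u k) p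
        have h7 : f p ≤ φ := hp.2
        rw [← neg_sub (u k) p, inner_neg_right] at h6
        linarith
      have h8 := mul_le_mul_of_nonneg_left h5 hτ.le
      have h9 : 0 ≤ β * (1 - β) / 2 * ‖A (D (u k)) - A (u k)‖ ^ 2 := by
        have : 0 < 1 - β := by linarith
        positivity
      have h10 : b (u k) = Metric.infDist (A (u k)) (A '' S) ^ 2 := rfl
      rw [h10]
      linarith
    · intro ε hε
      obtain ⟨δ, hδ, hδ'⟩ := aux_compact U hU (fun x => ‖A (D x - x)‖ + max (f x - φ) 0) b
        (hrc.add ((hf.sub continuous_const).max continuous_const)) hbc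
        (fun x => by positivity) (by
          intro x hx h0
          have n1 := norm_nonneg (A (D x - x))
          have n2 : 0 ≤ max (f x - φ) 0 := le_max_right _ _
          have n3 : f x - φ ≤ max (f x - φ) 0 := le_max_left _ _
          have : x ∈ S := ⟨⟨hr0 x (by linarith), hx⟩, by
            show f x ≤ φ
            linarith⟩
          exact (hbS x this).le) ε hε
      obtain ⟨N, hN⟩ := (hres.eventually_lt_const (half_pos hδ)).exists_forall_of_atTop
      refine ⟨δ / 2, half_pos hδ, N, fun k hk hbk => ?_⟩
      have h1 := hδ' (u k) (hu k) hbk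
      have h2 := hN k hk
      rcases max_choice (f (u k) - φ) 0 with h3 | h3 <;> rw [h3] at h1 <;> linarith
  have hfl := aux_compact_tendsto U hU b (fun x => f x - φ) hbc (hf.sub continuous_const) hb0 (by
    intro x hx h0
    have h1 := hSb x h0
    have h2 : f x ≤ φ := h1.2
    have h3 := hpm' x h1.1
    linarith) u hu hblim
  simpa using hfl.add_const φ

lemma aux_factor {n : ℕ} (H : Matrix (Fin n) (Fin n) ℝ) (hH : H.PosDef) :
    ∃ A : EuclideanSpace ℝ (Fin n) →L[ℝ] EuclideanSpace ℝ (Fin n),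
      ∀ x y, hIP H x y = ⟪A x, A y⟫ := by
  obtain ⟨B, hB⟩ : ∃ B : Matrix (Fin n) (Fin n) ℝ, H = B.conjTranspose * B := by
    open scoped MatrixOrder Matrix.Norms.L2Operator in
    obtain ⟨B, hB⟩ := CStarAlgebra.nonneg_iff_eq_star_mul_self.mp hH.posSemidef.nonneg
    exact ⟨B, hB⟩
  refine ⟨(Matrix.toEuclideanLin B).toContinuousLinearMap, fun x y => ?_⟩
  rw [hIP, hB]
  have h1 : Matrix.toEuclideanLin (B.conjTranspose * B) y =
      Matrix.toEuclideanLin B.conjTranspose (Matrix.toEuclideanLin B y) := by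
    simp [Matrix.toEuclideanLin_apply, Matrix.mulVec_mulVec]
  rw [h1, Matrix.toEuclideanLin_conjTranspose_eq_adjoint, LinearMap.adjoint_inner_right]
  rfl

lemma aux_inv {n : ℕ} (H : Matrix (Fin n) (Fin n) ℝ) (hH : H.PosDef)
    (x g : EuclideanSpace ℝ (Fin n)) :
    hIP H x (Matrix.toEuclideanLin H⁻¹ g) = ⟪x, g⟫ := by
  rw [hIP]
  congr 1
  have : IsUnit H.det := (Matrix.isUnit_iff_isUnit_det H).1 hH.isUnit
  simp [Matrix.toEuclideanLin_apply, Matrix.mulVec_mulVec, Matrix.mul_nonsing_inv H this]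

lemma aux_lower {n : ℕ} (H : Matrix (Fin n) (Fin n) ℝ) (hH : H.PosDef) :
    ∃ c > 0, ∀ x, (c * ‖x‖) ^ 2 ≤ hIP H x x := by
  obtain ⟨A, hA⟩ := aux_factor H hH
  have hker : LinearMap.ker (A : EuclideanSpace ℝ (Fin n) →ₗ[ℝ] EuclideanSpace ℝ (Fin n)) = ⊥ := by
    rw [LinearMap.ker_eq_bot']
    intro x hx
    by_contra hne
    have h1 : hIP H x x = 0 := by
      rw [hA]
      have : A x = 0 := hx
      rw [this, inner_zero_left]
    have hne' : x.ofLp ≠ 0 := by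
      intro h; apply hne; ext i; simp [h]
    have h2 := hH.dotProduct_mulVec_pos hne'
    have h3 : hIP H x x = star x.ofLp ⬝ᵥ (H.mulVec x.ofLp) := by
      rw [hIP, EuclideanSpace.inner_eq_star_dotProduct, Matrix.ofLp_toEuclideanLin_apply,
        dotProduct_comm]
    linarith
  obtain ⟨K, hK, hanti⟩ := LinearMap.exists_antilipschitzWith _ hker
  have hKp : (0:ℝ) < K := by exact_mod_cast hK
  refine ⟨(K:ℝ)⁻¹, by positivity, fun x => ?_⟩
  rw [hA, real_inner_self_eq_norm_sq]
  have h1 := hanti.le_mul_dist x 0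
  simp only [map_zero, dist_zero_right] at h1
  have h2 : (K:ℝ)⁻¹ * ‖x‖ ≤ ‖A x‖ := by
    rw [inv_mul_le_iff₀ hKp]; exact h1
  gcongr

lemma aux_bound_tendsto (C : ℝ) : Tendsto (fun k : ℕ => C * Real.sqrt
    ((1 + Real.log (1 + (k : ℝ))) / (k : ℝ) ^ ((1 : ℝ) / 4))) atTop (𝓝 0) := by
  have h1 : Tendsto (fun x : ℝ => (1 + Real.log (1 + x)) / x ^ ((1 : ℝ) / 4)) atTop (𝓝 0) := by
    have hpow : Tendsto (fun x : ℝ => x ^ ((1 : ℝ) / 4)) atTop atTop :=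
      tendsto_rpow_atTop (by norm_num)
    have ha : Tendsto (fun x : ℝ => Real.log x / x ^ ((1 : ℝ) / 4)) atTop (𝓝 0) :=
      (isLittleO_log_rpow_atTop (by norm_num)).tendsto_div_nhds_zero
    have hb : Tendsto (fun x : ℝ => (1 + Real.log 2) / x ^ ((1 : ℝ) / 4)) atTop (𝓝 0) :=
      tendsto_const_nhds.div_atTop hpow
    have hab := hb.add ha
    rw [add_zero] at hab
    refine squeeze_zero' ?_ ?_ hab
    · filter_upwards [eventually_ge_atTop 1] with x hx
      have : 0 ≤ Real.log (1 + x) := Real.log_nonneg (by linarith)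
      positivity
    · filter_upwards [eventually_ge_atTop 1] with x hx
      have hl : Real.log (1 + x) ≤ Real.log 2 + Real.log x := by
        rw [← Real.log_mul (by norm_num) (by linarith)]
        exact Real.log_le_log (by linarith) (by linarith)
      rw [← add_div]
      have : 0 < x ^ ((1 : ℝ) / 4) := by positivity
      exact div_le_div_of_nonneg_right (by linarith) this.le
  have h2 := (h1.comp tendsto_natCast_atTop_atTop).sqrt.const_mul C
  simpa using h2

/-- joint convergence of the parameterized aggregated iteration
(Theorem 1 of the paper): pointwise convergence of `dist(u^k(ω), Fix(T(·,ω)))`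
and of `ℓ(u^k(ω),ω)` to `φ(ω)`, together with a uniform fixed-point residual
bound `‖u^k(ω) − T(u^k(ω),ω)‖²_{H_lb} ≤ C √((1+ln(1+k))/k^{1/4})`. -/
theorem stmt_11 {n m : ℕ}
    (Ω : Set (EuclideanSpace ℝ (Fin m))) (hΩcp : IsCompact Ω)
    (U : Set (EuclideanSpace ℝ (Fin n)))
    (hUne : U.Nonempty) (hUco : Convex ℝ U) (hUcp : IsCompact U)
    (ℓ : EuclideanSpace ℝ (Fin n) → EuclideanSpace ℝ (Fin m) → ℝ)
    (hℓc : Continuous fun p : EuclideanSpace ℝ (Fin n) × EuclideanSpace ℝ (Fin m) =>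
      ℓ p.1 p.2)
    (L M₀ : ℝ) (hL : 0 < L)
    (hconv : ∀ ω ∈ Ω, ConvexOn ℝ Set.univ fun x => ℓ x ω)
    (hdiff : ∀ ω ∈ Ω, Differentiable ℝ fun x => ℓ x ω)
    (hLip : ∀ ω ∈ Ω, ∀ u v,
      ‖gradient (fun x => ℓ x ω) u - gradient (fun x => ℓ x ω) v‖ ≤ L * ‖u - v‖)
    (hbdd : ∀ ω ∈ Ω, ∀ x, M₀ ≤ ℓ x ω)
    (Hlb Hub : Matrix (Fin n) (Fin n) ℝ) (hlb : Hlb.PosDef) (hub : Hub.PosDef)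
    (HM : EuclideanSpace ℝ (Fin m) → Matrix (Fin n) (Fin n) ℝ)
    (hHM : ∀ ω ∈ Ω, (HM ω).PosDef)
    (hHMlb : ∀ ω ∈ Ω, ∀ x, hIP Hlb x x ≤ hIP (HM ω) x x)
    (hHMub : ∀ ω ∈ Ω, ∀ x, hIP (HM ω) x x ≤ hIP Hub x x)
    (D : EuclideanSpace ℝ (Fin n) → EuclideanSpace ℝ (Fin m) → EuclideanSpace ℝ (Fin n))
    (hD : ∀ ω ∈ Ω, ∀ u₁ u₂,
      hNorm (HM ω) (D u₁ ω - D u₂ ω) ≤ hNorm (HM ω) (u₁ - u₂))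
    (α μ : ℝ) (hα : α ∈ Set.Ioo (0 : ℝ) 1) (hμ : μ ∈ Set.Ioo (0 : ℝ) 1)
    (s : ℝ) (hs : s ∈ Set.Ioo 0 (lambdaMin Hlb hlb.1 / L))
    (T : EuclideanSpace ℝ (Fin n) → EuclideanSpace ℝ (Fin m) → EuclideanSpace ℝ (Fin n))
    (hT : ∀ x ω, T x ω = (1 - α) • x + α • D x ω)
    (hFix : ∀ ω ∈ Ω, ({x | T x ω = x} ∩ U).Nonempty)
    (u vl vu : ℕ → EuclideanSpace ℝ (Fin m) → EuclideanSpace ℝ (Fin n))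
    (hu0 : ∀ ω ∈ Ω, u 0 ω ∈ U)
    (hvl : ∀ ω ∈ Ω, ∀ k, vl (k + 1) ω = T (u k ω) ω)
    (hvu : ∀ ω ∈ Ω, ∀ k, vu (k + 1) ω =
      u k ω - (s / ((k : ℝ) + 1)) •
        Matrix.toEuclideanLin (HM ω)⁻¹ (gradient (fun x => ℓ x ω) (u k ω)))
    (hproj : ∀ ω ∈ Ω, ∀ k, u (k + 1) ω ∈ U ∧ ∀ w ∈ U,
      hNorm (HM ω) (u (k + 1) ω - (μ • vu (k + 1) ω + (1 - μ) • vl (k + 1) ω)) ≤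
        hNorm (HM ω) (w - (μ • vu (k + 1) ω + (1 - μ) • vl (k + 1) ω))) :
    (∀ ω ∈ Ω,
      Tendsto (fun k => Metric.infDist (u k ω) {x | T x ω = x}) atTop (𝓝 0) ∧
      Tendsto (fun k => ℓ (u k ω) ω) atTop
        (𝓝 (sInf ((fun x => ℓ x ω) '' ({x | T x ω = x} ∩ U))))) ∧
    ∃ C : ℝ, 0 < C ∧ ∀ ω ∈ Ω, ∀ k : ℕ, 2 ≤ k →
      hNorm Hlb (u k ω - T (u k ω) ω) ^ 2 ≤
        C * Real.sqrt ((1 + Real.log (1 + (k : ℝ))) / (k : ℝ) ^ ((1 : ℝ) / 4)) := by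
  
  -- uniform constants
  obtain ⟨c0, hc0, hc0'⟩ := aux_lower Hlb hlb
  obtain ⟨A2, hA2⟩ := aux_factor Hub hub
  have hα0 := hα.1
  have hμ0 := hμ.1
  have h1α : 0 < 1 - α := by linarith [hα.2]
  have h1μ : 0 < 1 - μ := by linarith [hμ.2]
  have hs0 := hs.1
  set β := (1 - μ) * α with hβdef
  have hβ : 0 < β := by positivity
  have hβ1 : β < 1 := by nlinarith [hα.2]
  have ht : 0 < μ * s := by positivity
  obtain ⟨B, hB⟩ := ((hUcp.add (isCompact_closedBall (0 : EuclideanSpace ℝ (Fin n)) 1)).prod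
    hΩcp).exists_bound_of_continuousOn hℓc.continuousOn
  have hBU : ∀ ω ∈ Ω, ∀ x ∈ U, ∀ d : EuclideanSpace ℝ (Fin n), ‖d‖ ≤ 1 → |ℓ (x + d) ω| ≤ B := by
    intro ω hω x hx d hd
    exact hB (x + d, ω) ⟨Set.add_mem_add hx (by simpa using hd), hω⟩
  have hBU0 : ∀ ω ∈ Ω, ∀ x ∈ U, |ℓ x ω| ≤ B := by
    intro ω hω x hx
    simpa using hBU ω hω x hx 0 (by simp)
  set M := 2 * |B| with hMdef
  have hM0 : 0 ≤ M := by positivity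
  have hM : ∀ ω ∈ Ω, ∀ x ∈ U, ∀ y ∈ U, ℓ x ω - ℓ y ω ≤ M := by
    intro ω hω x hx y hy
    have h1 := abs_le.1 (hBU0 ω hω x hx)
    have h2 := abs_le.1 (hBU0 ω hω y hy)
    linarith [le_abs_self B, h1.1, h1.2, h2.1, h2.2]
  have hgi : ∀ ω ∈ Ω, ∀ x y, ℓ x ω + ⟪gradient (fun x => ℓ x ω) x, y - x⟫ ≤ ℓ y ω :=
    fun ω hω x y => aux_grad_ineq (fun x => ℓ x ω) (hconv ω hω) (hdiff ω hω) x y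
  have hgb : ∀ ω ∈ Ω, ∀ x ∈ U, ‖gradient (fun x => ℓ x ω) x‖ ≤ M := by
    intro ω hω x hx
    set g := gradient (fun x => ℓ x ω) x with hgdef
    rcases eq_or_ne g 0 with h0 | h0
    · rw [h0, norm_zero]; exact hM0
    have hgp : 0 < ‖g‖ := norm_pos_iff.2 h0
    have h1 := hgi ω hω x (x + ‖g‖⁻¹ • g)
    rw [add_sub_cancel_left, ← hgdef, inner_smul_right, real_inner_self_eq_norm_sq] at h1
    have h2 : ‖g‖⁻¹ * ‖g‖ ^ 2 = ‖g‖ := by field_simp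
    rw [h2] at h1
    have h3 := abs_le.1 (hBU ω hω x hx (‖g‖⁻¹ • g) (by
      rw [norm_smul, norm_inv, norm_norm, inv_mul_cancel₀ hgp.ne']))
    have h4 := abs_le.1 (hBU0 ω hω x hx)
    linarith [le_abs_self B, h3.2, h4.1]
  obtain ⟨R0, hR0⟩ := hUcp.isBounded.exists_norm_le
  set R := ‖A2‖ * (2 * |R0|) + 1 with hRdef
  have hR : 0 < R := by positivity
  obtain ⟨C, hC, hrate⟩ := aux_vec_rate (E := EuclideanSpace ℝ (Fin n)) (μ * s) β (M / c0) M R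
    ht hβ hβ1 (by positivity) hM0 hR
  have hTD : ∀ ω, {x | T x ω = x} = {x | D x ω = x} := by
    intro ω
    ext x
    simp only [Set.mem_setOf_eq, hT]
    constructor
    · intro h
      have h1 : α • (D x ω - x) = 0 := by
        have : (1 - α) • x + α • D x ω - x = α • (D x ω - x) := by module
        rw [← this, h, sub_self]
      exact sub_eq_zero.1 ((smul_eq_zero.1 h1).resolve_left hα0.ne')
    · intro h
      rw [h]; module
  have hu : ∀ ω ∈ Ω, ∀ k, u k ω ∈ U := by
    intro ω hω k
    cases k with
    | zero => exact hu0 ω hω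
    | succ k => exact (hproj ω hω k).1
  -- everything at a fixed parameter
  have main : ∀ ω ∈ Ω, ∃ A : EuclideanSpace ℝ (Fin n) →L[ℝ] EuclideanSpace ℝ (Fin n),
      (∀ x, hIP (HM ω) x x = ‖A x‖ ^ 2) ∧
      (∀ k : ℕ, 2 ≤ k → ‖A (D (u k ω) ω - u k ω)‖ ^ 2 ≤
        C * Real.sqrt ((1 + Real.log (1 + (k : ℝ))) / (k : ℝ) ^ ((1 : ℝ) / 4))) ∧
      (Tendsto (fun k => ‖A (D (u k ω) ω - u k ω)‖) atTop (𝓝 0) →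
        Tendsto (fun k => Metric.infDist (u k ω) {x | D x ω = x}) atTop (𝓝 0) ∧
        Tendsto (fun k => ℓ (u k ω) ω) atTop
          (𝓝 (sInf ((fun x => ℓ x ω) '' ({x | D x ω = x} ∩ U))))) := by
    intro ω hω
    obtain ⟨A, hA⟩ := aux_factor (HM ω) (hHM ω hω)
    have hAn : ∀ x, hIP (HM ω) x x = ‖A x‖ ^ 2 := by
      intro x; rw [hA, real_inner_self_eq_norm_sq]
    have hN : ∀ x, hNorm (HM ω) x = ‖A x‖ := by
      intro x; rw [hNorm, hAn, Real.sqrt_sq (norm_nonneg _)]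
    have hAlow : ∀ x, c0 * ‖x‖ ≤ ‖A x‖ := by
      intro x
      refine le_of_sq_le_sq ?_ (norm_nonneg _)
      rw [← hAn]
      exact (hc0' x).trans (hHMlb ω hω x)
    have hAup : ∀ x, ‖A x‖ ≤ ‖A2‖ * ‖x‖ := by
      intro x
      refine le_trans ?_ (A2.le_opNorm x)
      refine le_of_sq_le_sq ?_ (norm_nonneg _)
      rw [← hAn, ← real_inner_self_eq_norm_sq, ← hA2]
      exact hHMub ω hω x
    set g := gradient (fun x => ℓ x ω) with hgdef
    set w : ℕ → EuclideanSpace ℝ (Fin n) := fun k => Matrix.toEuclideanLin (HM ω)⁻¹ (g (u k ω))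
      with hwdef
    have hw : ∀ k x, ⟪A (w k), A x⟫ = ⟪g (u k ω), x⟫ := by
      intro k x
      rw [real_inner_comm, ← hA, hwdef, aux_inv (HM ω) (hHM ω hω), real_inner_comm]
    have hwG : ∀ k, ‖A (w k)‖ ≤ M / c0 := by
      intro k
      rw [le_div_iff₀ hc0]
      rcases (norm_nonneg (A (w k))).eq_or_lt with h0 | h0
      · rw [← h0, zero_mul]; exact hM0
      have h1 := hw k (w k)
      rw [real_inner_self_eq_norm_sq] at h1
      have h2 := real_inner_le_norm (g (u k ω)) (w k)
      have h3 : ‖g (u k ω)‖ * ‖w k‖ ≤ M * ‖w k‖ := by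
        have := hgb ω hω _ (hu ω hω k)
        gcongr
      have h4 := mul_le_mul_of_nonneg_left (hAlow (w k)) hM0
      have h5 : ‖A (w k)‖ * (‖A (w k)‖ * c0) ≤ ‖A (w k)‖ * M := by nlinarith
      exact le_of_mul_le_mul_left h5 h0
    have hDn : ∀ x y, ‖A (D x ω - D y ω)‖ ≤ ‖A (x - y)‖ := by
      intro x y
      have := hD ω hω x y
      rwa [hN, hN] at this
    have hz : ∀ k, μ • vu (k + 1) ω + (1 - μ) • vl (k + 1) ω =
        u k ω - ((μ * s) / ((k:ℝ) + 1)) • w k + β • (D (u k ω) ω - u k ω) := by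
      intro k
      rw [hvu ω hω, hvl ω hω, hT, mul_div_assoc]
      simp only [hwdef, hβdef]
      module
    have hVco : Convex ℝ (A '' U) := hUco.linear_image
      (A : EuclideanSpace ℝ (Fin n) →ₗ[ℝ] EuclideanSpace ℝ (Fin n))
    have hvi' : ∀ k : ℕ, ∀ v ∈ U, ⟪A ((u k ω - ((μ * s) / ((k:ℝ) + 1)) • w k
        + β • (D (u k ω) ω - u k ω)) - u (k + 1) ω), A (v - u (k + 1) ω)⟫ ≤ 0 := by
      intro k v hv
      rw [map_sub, map_sub A v]
      refine aux_proj_vi (A '' U) hVco _ _ (Set.mem_image_of_mem A (hu ω hω (k + 1))) ?_ _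
        (Set.mem_image_of_mem A hv)
      rintro _ ⟨y, hy, rfl⟩
      have := (hproj ω hω k).2 y hy
      rwa [hz, hN, hN, map_sub, map_sub] at this
    obtain ⟨p, hp⟩ := hFix ω hω
    rw [hTD] at hp
    have hDp : D p ω = p := hp.1
    refine ⟨A, hAn, ?_, ?_⟩
    · intro k hk
      have := hrate (A '' U) (fun k => A (u k ω)) (fun k => A (D (u k ω) ω)) (fun k => A (w k))
        (A p) (Set.mem_image_of_mem A hp.2) (fun k => Set.mem_image_of_mem A (hu ω hω k))
        (by
          rintro _ ⟨x, hx, rfl⟩ _ ⟨y, hy, rfl⟩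
          rw [← map_sub]
          have h1 := hAup (x - y)
          have h2 := norm_sub_le x y
          have h3 := hR0 x hx
          have h4 := hR0 y hy
          have h5 : ‖x - y‖ ≤ 2 * |R0| := by linarith [le_abs_self R0]
          have h6 : ‖A2‖ * ‖x - y‖ ≤ ‖A2‖ * (2 * |R0|) := by gcongr
          linarith)
        (by
          rintro k _ ⟨v, hv, rfl⟩
          have := hvi' k v hv
          simpa only [map_sub, map_add, map_smul] using this)
        (by
          intro k
          have := hDn (u k ω) p
          rwa [hDp, map_sub, map_sub] at this)
        (by
          intro k
          have := hDn (u (k + 1) ω) (u k ω)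
          rwa [map_sub, map_sub] at this)
        hwG
        (by
          intro k
          have h1 := hgi ω hω (u k ω) p
          have h2 := hM ω hω p hp.2 (u k ω) (hu ω hω k)
          rw [← map_sub, hw, ← inner_neg_right, neg_sub]
          linarith)
        k hk
      rwa [← map_sub] at this
    · intro hres
      exact aux_conv U hUcp A c0 hc0 hAlow (fun x => D x ω) hDn (fun x => ℓ x ω)
        (by fun_prop) g (hgi ω hω) ⟨p, hp⟩ (fun k => u k ω) w (hu ω hω) hw (μ * s) β (M / c0) M
        ht hβ hβ1 hwG (hM ω hω) hvi' hres
  have hbound0 : Tendsto (fun k : ℕ => C * Real.sqrt ((1 + Real.log (1 + (k : ℝ))) /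
      (k : ℝ) ^ ((1 : ℝ) / 4))) atTop (𝓝 0) := aux_bound_tendsto C
  refine ⟨?_, C, hC, ?_⟩
  · intro ω hω
    obtain ⟨A, -, h1, h2⟩ := main ω hω
    rw [hTD]
    apply h2
    have hsq : Tendsto (fun k => ‖A (D (u k ω) ω - u k ω)‖ ^ 2) atTop (𝓝 0) := by
      refine squeeze_zero' (Eventually.of_forall fun k => by positivity) ?_ hbound0
      filter_upwards [eventually_ge_atTop 2] with k hk using h1 k hk
    have := hsq.sqrt
    simpa [Real.sqrt_sq] using this
  · intro ω hω k hk
    obtain ⟨A, hAn, h1, -⟩ := main ω hω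
    refine le_trans ?_ (h1 k hk)
    have e : u k ω - T (u k ω) ω = (-α) • (D (u k ω) ω - u k ω) := by rw [hT]; module
    have hpos : 0 ≤ hIP Hlb (u k ω - T (u k ω) ω) (u k ω - T (u k ω) ω) :=
      (sq_nonneg _).trans (hc0' _)
    rw [hNorm, Real.sq_sqrt hpos]
    refine (hHMlb ω hω _).trans ?_
    rw [hAn, e, map_smul, norm_smul, mul_pow, norm_neg, Real.norm_of_nonneg hα0.le]
    have : α ^ 2 ≤ 1 := by nlinarith
    have h5 := sq_nonneg ‖A (D (u k ω) ω - u k ω)‖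
    nlinarith
end
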